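/- There exists K > 0 such that for every matrix g = (a b; c d) in ℳ different from the identity and from (0 1; 1 1) (so that d > b > 0), and every φ ∈ 𝒪¹(ℂ̄∖[0,1]) with ‖φ‖_{H¹} < ∞, one has ‖L_g φ‖_{H¹} ≤ K·d^{−5/2}·(min(b, d − b))^{−1/2}·log(1 + d)·‖φ‖_{H¹}. -/

import Mathlib

open Complex Filter Set Topology
open scoped ENNReal NNReal

noncomputable section

/-- The complement in `ℂ` of the real segment `[a, b]`. -/
def cutPlane (a b : ℝ) : Set ℂ := (Complex.ofReal '' Set.Icc a b)ᶜ

/-- `𝒪¹(ℂ̄ ∖ [a,b])`: holomorphic on `ℂ ∖ [a,b]`, vanishing at infinity. -/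
def O1 (a b : ℝ) : Set (ℂ → ℂ) :=
  {φ | DifferentiableOn ℂ φ (cutPlane a b) ∧
       Tendsto φ (Bornology.cobounded ℂ) (nhds 0)}

/-- `𝒪³(ℂ̄ ∖ [a,b])`: holomorphic on `ℂ ∖ [a,b]`, with `z²ψ(z) → 0` at infinity. -/
def O3 (a b : ℝ) : Set (ℂ → ℂ) :=
  {ψ | DifferentiableOn ℂ ψ (cutPlane a b) ∧
       Tendsto (fun z => z ^ 2 * ψ z) (Bornology.cobounded ℂ) (nhds 0)}

/-- The `m`-th term (for the integer `m+1 ≥ 1`) of the series defining `T`. -/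
def Tterm (φ : ℂ → ℂ) (m : ℕ) (z : ℂ) : ℂ :=
  -z * (φ (z⁻¹ - ((m : ℂ) + 1)) - φ (-((m : ℂ) + 1))) + deriv φ (-((m : ℂ) + 1))

/-- The operator `T`. -/
def Tbrj (φ : ℂ → ℂ) : ℂ → ℂ := fun z => ∑' m : ℕ, Tterm φ m z

/-- The operator `T⁽³⁾`. -/
def T3brj (ψ : ℂ → ℂ) : ℂ → ℂ := fun z => -∑' m : ℕ, (z⁻¹) ^ 3 * ψ (z⁻¹ - ((m : ℂ) + 1))

/-- `g(m) = (0 1; 1 m)`. -/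
def gmat (m : ℤ) : Matrix (Fin 2) (Fin 2) ℤ := !![0, 1; 1, m]

/-- The monoid `ℳ`. -/
def Mmon : Set (Matrix (Fin 2) (Fin 2) ℤ) :=
  {g | g = 1 ∨
    ((g 0 0 * g 1 1 - g 0 1 * g 1 0 = 1 ∨ g 0 0 * g 1 1 - g 0 1 * g 1 0 = -1) ∧
      g 0 1 ≤ g 1 1 ∧ g 0 0 ≤ g 0 1 ∧ 0 ≤ g 0 0 ∧ g 1 0 ≤ g 1 1 ∧ g 0 0 ≤ g 1 0)}

/-- The operator `L_g` on `𝒪¹(ℂ̄ ∖ [0,1])`, for `g = (a b; c d) ∈ ℳ`. -/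
def Lop (g : Matrix (Fin 2) (Fin 2) ℤ) (φ : ℂ → ℂ) : ℂ → ℂ := fun z =>
  if g = 1 then φ z
  else
    ((g 0 0 : ℂ) - (g 1 0 : ℂ) * z) *
        (φ (((g 1 1 : ℂ) * z - (g 0 1 : ℂ)) / ((g 0 0 : ℂ) - (g 1 0 : ℂ) * z)) -
          φ (-(g 1 1 : ℂ) / (g 1 0 : ℂ))) -
      ((g 0 0 * g 1 1 - g 0 1 * g 1 0 : ℤ) : ℂ) * ((g 1 0 : ℂ))⁻¹ *
        deriv φ (-(g 1 1 : ℂ) / (g 1 0 : ℂ))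

/-- `Σ_ℳ φ`, the sum of the family `(L_g φ)_{g ∈ ℳ}`. -/
def sumM (φ : ℂ → ℂ) : ℂ → ℂ := fun z => ∑' g : Mmon, Lop g.1 φ z

/-- The domain `D`. -/
def Dset : Set ℂ :=
  {z | ‖z‖ ≤ 1 ∧ 1 ≤ ‖z - Complex.I‖ ∧ 1 ≤ ‖z + Complex.I‖ ∧ 0 < z.re}

/-- The domain `D₀`. -/
def D0set : Set ℂ := {z | ‖z + 1‖ ≤ 1 ∧ Real.sqrt 3 / 2 - 1 ≤ z.re}

/-- The domain `D₁`. -/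
def D1set : Set ℂ :=
  {z | 1 ≤ ‖z‖ ∧ ‖z - (1 / Real.sqrt 3 : ℝ)‖ ≤ 1 / Real.sqrt 3}

/-- The domain `H₀`. -/
def H0set : Set ℂ := {z | ‖z - Complex.I‖ ≤ 1 ∧ 1 ≤ ‖z + 1‖ ∧ z.im ≤ 1 / 2}

/-- The domain `H₀′`. -/
def H0set' : Set ℂ := {z | (starRingEnd ℂ) z ∈ H0set}

/-- The domain `Δ`. -/
def Δset : Set ℂ := {z | ‖z‖ ≤ 1 ∧ 1 ≤ ‖z + 1‖ ∧ |z.im| ≤ 1 / 2}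

/-- The domain `D∞`. -/
def Dinf : Set ℂ :=
  {z | 1 / 2 < |z.im|} ∪ {z | z.re < Real.sqrt 3 / 2 - 1} ∪
    {z | Real.sqrt 3 / 2 < z.re ∧ 1 / Real.sqrt 3 < ‖z - (1 / Real.sqrt 3 : ℝ)‖}

end

noncomputable section

/-- Transfer of `φ ∈ 𝒪¹(ℂ̄∖[0,1])` to the unit disc via `w ↦ (w+1)²/(4w)`. -/
def Fdisc (φ : ℂ → ℂ) : ℂ → ℂ := fun w =>
  if w = 0 then 0 else φ ((w + 1) ^ 2 / (4 * w))

/-- The `H¹` norm of `φ ∈ 𝒪¹(ℂ̄∖[0,1])`. -/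
def Hnorm (φ : ℂ → ℂ) : ℝ≥0∞ :=
  ⨆ r : Set.Ioo (0 : ℝ) 1,
    ENNReal.ofReal
      ((2 * Real.pi)⁻¹ *
        ∫ θ in (0 : ℝ)..(2 * Real.pi),
          ‖Fdisc φ ((r : ℝ) * Complex.exp (θ * Complex.I))‖)

/-- The Joukowski map `w ↦ (w + 1)² / (4 w)`. -/
def joukowski (w : ℂ) : ℂ := (w + 1) ^ 2 / (4 * w)

/-- The point of `[0, 1]` below `e^{iθ}` under the Joukowski map. -/
def segPoint (θ : ℝ) : ℝ := (1 + Real.cos θ) / 2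

lemma continuous_segPoint : Continuous segPoint := by
  unfold segPoint; fun_prop

lemma segPoint_mem_Icc (θ : ℝ) : segPoint θ ∈ Icc (0 : ℝ) 1 := by
  have h1 := Real.neg_one_le_cos θ
  have h2 := Real.cos_le_one θ
  constructor <;> unfold segPoint <;> linarith

lemma abs_sin_div_two (θ : ℝ) :
    |Real.sin θ| / 2 = √(segPoint θ * (1 - segPoint θ)) := by
  have : segPoint θ * (1 - segPoint θ) = (|Real.sin θ| / 2) ^ 2 := by
    rw [div_pow, sq_abs, Real.sin_sq]; unfold segPoint; ring
  rw [this, Real.sqrt_sq (by positivity)]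

lemma ofReal_segPoint (θ : ℝ) :
    ((segPoint θ : ℝ) : ℂ) = joukowski (Complex.exp (θ * I)) := by
  unfold segPoint joukowski
  have h := Complex.exp_ne_zero (θ * I)
  push_cast
  rw [Complex.cos, neg_mul, Complex.exp_neg]
  field_simp
  ring

lemma I_mul_sin_div_two (θ : ℝ) :
    I * (Real.sin θ : ℂ) / 2 =
      (Complex.exp (θ * I) ^ 2 - 1) / (4 * Complex.exp (θ * I)) := by
  have h := Complex.exp_ne_zero (θ * I)
  push_cast
  rw [Complex.sin, neg_mul, Complex.exp_neg]
  generalize Complex.exp (θ * I) = e at h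
  field_simp
  linear_combination 4 * (1 - e ^ 2) * I_sq

lemma joukowski_sub {v w : ℂ} (hv : v ≠ 0) (hw : w ≠ 0) :
    joukowski v - joukowski w = (v - w) * (v * w - 1) / (4 * v * w) := by
  unfold joukowski; field_simp; ring

lemma exists_segPoint_eq {y : ℝ} (hy : y ∈ Icc (0 : ℝ) 1) :
    ∃ θ ∈ Icc 0 Real.pi, segPoint θ = y := by
  refine ⟨Real.arccos (2 * y - 1), ⟨Real.arccos_nonneg _, Real.arccos_le_pi _⟩, ?_⟩
  unfold segPoint
  rw [Real.cos_arccos] <;> linarith [hy.1, hy.2]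

/-- Distance from `w` to the two boundary points above `y ∈ [0, 1]`. -/
lemma sub_exp_mul_sub_exp {w : ℂ} (hw : w ≠ 0) (τ : ℝ) :
    (w - Complex.exp (τ * I)) * (w - Complex.exp (-τ * I)) =
      4 * w * (joukowski w - segPoint τ) := by
  have h := Complex.exp_ne_zero (τ * I)
  rw [ofReal_segPoint, joukowski_sub hw h, neg_mul, Complex.exp_neg]
  field_simp

lemma joukowski_mem_cutPlane {w : ℂ} (hw : w ≠ 0) (hw1 : ‖w‖ < 1) :
    joukowski w ∈ cutPlane 0 1 := by
  rintro ⟨y, hy, hyw⟩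
  obtain ⟨τ, -, rfl⟩ := exists_segPoint_eq hy
  have h := sub_exp_mul_sub_exp hw τ
  rw [hyw, sub_self, mul_zero, mul_eq_zero, sub_eq_zero, sub_eq_zero] at h
  rcases h with h | h
  · rw [h, Complex.norm_exp_ofReal_mul_I] at hw1; exact lt_irrefl _ hw1
  · rw [h, ← Complex.ofReal_neg, Complex.norm_exp_ofReal_mul_I] at hw1; exact lt_irrefl _ hw1

lemma joukowski_inv {w : ℂ} (hw : w ≠ 0) : joukowski w⁻¹ = joukowski w := by
  unfold joukowski; field_simp; ring

lemma norm_mem_of_joukowski {w : ℂ} (hw1 : ‖w‖ = 1) : ∃ y ∈ Icc (0 : ℝ) 1, (y : ℂ) = joukowski w := by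
  refine ⟨segPoint w.arg, segPoint_mem_Icc _, ?_⟩
  rw [ofReal_segPoint]
  congr 1
  have := Complex.norm_mul_exp_arg_mul_I w
  rwa [hw1, Complex.ofReal_one, one_mul] at this

lemma exists_joukowski_eq {z : ℂ} (hz : z ∈ cutPlane 0 1) :
    ∃ w : ℂ, w ≠ 0 ∧ ‖w‖ < 1 ∧ joukowski w = z := by
  obtain ⟨s, hs⟩ := IsAlgClosed.exists_pow_nat_eq ((2 * z - 1) ^ 2 - 1) (n := 2) (by norm_num)
  have key : ∀ w : ℂ, w ≠ 0 → joukowski w = z → ∃ w : ℂ, w ≠ 0 ∧ ‖w‖ < 1 ∧ joukowski w = z := by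
    intro w hw hwz
    rcases lt_trichotomy ‖w‖ 1 with h | h | h
    · exact ⟨w, hw, h, hwz⟩
    · obtain ⟨y, hy, hyw⟩ := norm_mem_of_joukowski h
      exact absurd ⟨y, hy, hyw.trans hwz⟩ hz
    · exact ⟨w⁻¹, inv_ne_zero hw, by rw [norm_inv]; exact inv_lt_one_of_one_lt₀ h,
        (joukowski_inv hw).trans hwz⟩
  have h1 : (2 * z - 1 + s) * (2 * z - 1 - s) = 1 := by linear_combination -hs
  have h0 : 2 * z - 1 + s ≠ 0 := left_ne_zero_of_mul_eq_one h1
  refine key _ h0 ?_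
  unfold joukowski
  field_simp
  linear_combination hs

/-- Integration of `k` on `[0, 1]` against the density given by the boundary values of `f`. -/
def cutIntegral (f : ℂ → ℂ) (k : ℝ → ℂ) : ℂ :=
  (2 * Real.pi : ℂ)⁻¹ * ∫ θ in (0 : ℝ)..(2 * Real.pi),
    f (Complex.exp (θ * I)) * (I * (Real.sin θ : ℂ) / 2) * k (segPoint θ)

/-- The `L¹` mean of `f` on the unit circle. -/
def circleMean (f : ℂ → ℂ) : ℝ :=
  (2 * Real.pi)⁻¹ * ∫ θ in (0 : ℝ)..(2 * Real.pi), ‖f (Complex.exp (θ * I))‖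

section CutIntegral

variable {f : ℂ → ℂ} (hf : ContinuousOn f (Metric.closedBall 0 1))
include hf

lemma continuous_comp_exp : Continuous fun θ : ℝ => f (Complex.exp (θ * I)) :=
  hf.comp_continuous (by fun_prop) fun θ => by simp [Complex.norm_exp_ofReal_mul_I]

lemma continuous_cutIntegrand {k : ℝ → ℂ} (hk : ContinuousOn k (Icc 0 1)) :
    Continuous fun θ : ℝ =>
      f (Complex.exp (θ * I)) * (I * (Real.sin θ : ℂ) / 2) * k (segPoint θ) :=
  ((continuous_comp_exp hf).mul (by fun_prop)).mul
    (hk.comp_continuous continuous_segPoint segPoint_mem_Icc)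

lemma cutIntegral_sub {k l : ℝ → ℂ} (hk : ContinuousOn k (Icc 0 1))
    (hl : ContinuousOn l (Icc 0 1)) :
    cutIntegral f (fun y => k y - l y) = cutIntegral f k - cutIntegral f l := by
  unfold cutIntegral
  rw [← mul_sub, ← intervalIntegral.integral_sub
    ((continuous_cutIntegrand hf hk).intervalIntegrable _ _)
    ((continuous_cutIntegrand hf hl).intervalIntegrable _ _)]
  simp only [mul_sub]

omit hf in
lemma cutIntegral_const_mul (k : ℝ → ℂ) (t : ℂ) :
    cutIntegral f (fun y => t * k y) = t * cutIntegral f k := by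
  unfold cutIntegral
  rw [mul_left_comm, ← intervalIntegral.integral_const_mul (r := t)]
  congr 2
  funext θ
  ring

omit hf in
lemma cutIntegral_congr {k l : ℝ → ℂ} (h : ∀ y ∈ Icc (0 : ℝ) 1, k y = l y) :
    cutIntegral f k = cutIntegral f l := by
  unfold cutIntegral
  congr 2
  funext θ
  rw [h _ (segPoint_mem_Icc θ)]

omit hf in
lemma circleMean_nonneg : 0 ≤ circleMean f :=
  mul_nonneg (by positivity) (intervalIntegral.integral_nonneg (by positivity) fun _ _ => norm_nonneg _)

lemma norm_cutIntegral_le {k : ℝ → ℂ} {B : ℝ}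
    (hB : ∀ y ∈ Icc (0 : ℝ) 1, √(y * (1 - y)) * ‖k y‖ ≤ B) :
    ‖cutIntegral f k‖ ≤ B * circleMean f := by
  unfold cutIntegral circleMean
  have h2 : ‖(2 * Real.pi : ℂ)⁻¹‖ = (2 * Real.pi)⁻¹ := by
    rw [norm_inv]; norm_num [abs_of_pos Real.pi_pos]
  rw [norm_mul, h2, mul_left_comm, ← intervalIntegral.integral_const_mul]
  refine mul_le_mul_of_nonneg_left ?_ (by positivity)
  refine intervalIntegral.norm_integral_le_of_norm_le (by positivity) ?_
    ((continuous_const.mul (continuous_comp_exp hf).norm).intervalIntegrable _ _)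
  refine Eventually.of_forall fun θ _ => ?_
  have h3 : ‖I * (Real.sin θ : ℂ) / 2‖ = |Real.sin θ| / 2 := by
    rw [norm_div, norm_mul, Complex.norm_I, Complex.norm_real]; simp
  rw [norm_mul, norm_mul, h3, abs_sin_div_two, mul_assoc, mul_comm B]
  exact mul_le_mul_of_nonneg_left (hB _ (segPoint_mem_Icc θ)) (norm_nonneg _)

end CutIntegral

/-- Cauchy's formula for functions on the disc vanishing at the origin, in the variable of the
Joukowski map. -/
lemma cutIntegral_cauchy {f : ℂ → ℂ} {ρ : ℝ} (hρ : 1 < ρ)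
    (hf : DifferentiableOn ℂ f (Metric.ball 0 ρ)) (hf0 : f 0 = 0) {w : ℂ} (hw : w ≠ 0)
    (hw1 : ‖w‖ < 1) :
    cutIntegral f (fun y => (y - joukowski w)⁻¹) = f w := by
  have hsub : Metric.closedBall (0 : ℂ) 1 ⊆ Metric.ball 0 ρ := Metric.closedBall_subset_ball hρ
  have hne : ∀ ζ ∈ Metric.closedBall (0 : ℂ) 1, ζ * w - 1 ≠ 0 := by
    intro ζ hζ h
    have h2 : ‖ζ * w‖ = 1 := by rw [sub_eq_zero.1 h, norm_one]
    rw [norm_mul] at h2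
    have := mem_closedBall_zero_iff.1 hζ
    nlinarith [norm_nonneg ζ, norm_nonneg w]
  have hds : DifferentiableOn ℂ (dslope f 0) (Metric.closedBall 0 1) :=
    ((Complex.differentiableOn_dslope (Metric.ball_mem_nhds 0 (by linarith))).2 hf).mono hsub
  have hE : DifferentiableOn ℂ (fun ζ => dslope f 0 ζ * (ζ ^ 2 - 1) * w / (ζ * w - 1))
      (Metric.closedBall 0 1) :=
    ((hds.mul (by fun_prop)).mul_const w).div (by fun_prop) hne
  have hC := hE.circleIntegral_sub_inv_smul (mem_ball_zero_iff.2 hw1)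
  have hd : ∀ ζ : ℂ, ζ ≠ 0 → dslope f 0 ζ = f ζ / ζ := by
    intro ζ hζ
    rw [dslope_of_ne _ hζ, slope_def_field, hf0, sub_zero, sub_zero]
  have hw2 : w ^ 2 - 1 ≠ 0 := by
    have := hne w (mem_closedBall_zero_iff.2 hw1.le)
    rwa [sq]
  rw [hd w hw, circleIntegral] at hC
  have hmean_le : ∀ θ : ℝ, deriv (circleMap 0 1) θ • ((circleMap 0 1 θ - w)⁻¹ •
      (dslope f 0 (circleMap 0 1 θ) * (circleMap 0 1 θ ^ 2 - 1) * w / (circleMap 0 1 θ * w - 1)))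
      = I * (f (Complex.exp (θ * I)) * (I * (Real.sin θ : ℂ) / 2) *
        ((segPoint θ : ℂ) - joukowski w)⁻¹) := by
    intro θ
    have h0 := Complex.exp_ne_zero (θ * I)
    have h1 : ‖Complex.exp (θ * I)‖ = 1 := Complex.norm_exp_ofReal_mul_I θ
    rw [I_mul_sin_div_two, ofReal_segPoint, joukowski_sub h0 hw, deriv_circleMap]
    simp only [circleMap, zero_add, Complex.ofReal_one, one_mul, smul_eq_mul]
    rw [hd _ h0]
    have h3 := hne (Complex.exp (θ * I)) (by simp [h1])
    have h4 : Complex.exp (θ * I) - w ≠ 0 := by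
      intro h; rw [sub_eq_zero.1 h] at h1; linarith
    field_simp
  simp only [hmean_le] at hC
  rw [intervalIntegral.integral_const_mul] at hC
  unfold cutIntegral
  have hpi : (Real.pi : ℂ) ≠ 0 := by exact_mod_cast Real.pi_ne_zero
  have h5 : f w / w * (w ^ 2 - 1) * w / (w * w - 1) = f w := by
    rw [← sq]; field_simp
  rw [h5, smul_eq_mul, mul_comm (2 * (Real.pi : ℂ)) I, mul_assoc] at hC
  rw [mul_left_cancel₀ I_ne_zero hC]
  field_simp

/-- Differentiation of an integral with respect to a complex parameter. -/
lemma hasDerivAt_integral_mul {U : Set ℂ} (hU : IsOpen U) {s : ℝ → ℂ} {α β : ℝ}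
    (hs : IntervalIntegrable s MeasureTheory.volume α β) {k k' : ℂ → ℝ → ℂ}
    (hk : ContinuousOn (Function.uncurry k) (U ×ˢ univ))
    (hk' : ContinuousOn (Function.uncurry k') (U ×ˢ univ))
    (hd : ∀ w ∈ U, ∀ θ, HasDerivAt (fun v => k v θ) (k' w θ) w)
    {w₀ : ℂ} (hw₀ : w₀ ∈ U) :
    HasDerivAt (fun w => ∫ θ in α..β, s θ * k w θ) (∫ θ in α..β, s θ * k' w₀ θ) w₀ := by
  obtain ⟨δ, hδ, hδU⟩ := Metric.nhds_basis_closedBall.mem_iff.1 (hU.mem_nhds hw₀)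
  have hcont : ∀ {l : ℂ → ℝ → ℂ}, ContinuousOn (Function.uncurry l) (U ×ˢ univ) →
      ∀ w ∈ U, Continuous (l w) := by
    intro l hl w hw
    exact hl.comp_continuous (f := fun θ : ℝ => (w, θ)) (by fun_prop) fun θ => ⟨hw, mem_univ _⟩
  obtain ⟨M, hM⟩ := ((isCompact_closedBall w₀ δ).prod (isCompact_uIcc (a := α) (b := β))).exists_bound_of_continuousOn
    (hk'.mono (prod_mono hδU (subset_univ _)))
  have hmeas : MeasureTheory.AEStronglyMeasurable s
      (MeasureTheory.volume.restrict (uIoc α β)) := hs.def'.aestronglyMeasurable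
  refine (intervalIntegral.hasDerivAt_integral_of_dominated_loc_of_deriv_le
    (F := fun w θ => s θ * k w θ) (F' := fun w θ => s θ * k' w θ) (bound := fun θ => ‖s θ‖ * M)
    (Metric.closedBall_mem_nhds w₀ hδ) ?_ ?_ ?_ ?_ ?_ ?_).2
  · filter_upwards [hU.mem_nhds hw₀] with w hw
    exact hmeas.mul (hcont hk w hw).aestronglyMeasurable
  · exact hs.mul_continuousOn (hcont hk w₀ hw₀).continuousOn
  · exact hmeas.mul (hcont hk' w₀ hw₀).aestronglyMeasurable
  · refine Eventually.of_forall fun θ hθ w hw => ?_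
    rw [norm_mul]
    exact mul_le_mul_of_nonneg_left (hM (w, θ) ⟨hw, uIoc_subset_uIcc hθ⟩) (norm_nonneg _)
  · exact hs.norm.mul_const M
  · exact Eventually.of_forall fun θ _ w hw => (hd w (hδU hw) θ).const_mul (s θ)

lemma differentiableOn_integral_mul {U : Set ℂ} (hU : IsOpen U) {s : ℝ → ℂ} {α β : ℝ}
    (hs : IntervalIntegrable s MeasureTheory.volume α β) {k k' : ℂ → ℝ → ℂ}
    (hk : ContinuousOn (Function.uncurry k) (U ×ˢ univ))
    (hk' : ContinuousOn (Function.uncurry k') (U ×ˢ univ))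
    (hd : ∀ w ∈ U, ∀ θ, HasDerivAt (fun v => k v θ) (k' w θ) w) :
    DifferentiableOn ℂ (fun w => ∫ θ in α..β, s θ * k w θ) U := fun _ hw =>
  (hasDerivAt_integral_mul hU hs hk hk' hd hw).differentiableAt.differentiableWithinAt

lemma norm_ofReal_mul_exp {r : ℝ} (hr : 0 ≤ r) (θ : ℝ) : ‖(r : ℂ) * Complex.exp (θ * I)‖ = r := by
  rw [norm_mul, Complex.norm_exp_ofReal_mul_I, mul_one, Complex.norm_real, Real.norm_of_nonneg hr]

lemma continuous_comp_circle {G : ℂ → ℂ} (hG : ContinuousOn G (Metric.ball 0 1)) {r : ℝ}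
    (hr : 0 ≤ r) (hr1 : r < 1) : Continuous fun θ : ℝ => G (r * Complex.exp (θ * I)) :=
  hG.comp_continuous (by fun_prop) fun θ => by
    rw [mem_ball_zero_iff, norm_ofReal_mul_exp hr]; exact hr1

/-- Hardy's theorem: the `L¹` means of a holomorphic function increase with the radius. -/
lemma integral_norm_circle_mono {G : ℂ → ℂ} (hG : DifferentiableOn ℂ G (Metric.ball 0 1))
    {r r' : ℝ} (hr : 0 < r) (hrr' : r ≤ r') (hr' : r' < 1) :
    ∫ θ in (0 : ℝ)..(2 * Real.pi), ‖G (r * Complex.exp (θ * I))‖ ≤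
      ∫ θ in (0 : ℝ)..(2 * Real.pi), ‖G (r' * Complex.exp (θ * I))‖ := by
  have hr0' : 0 < r' := hr.trans_le hrr'
  set u : ℝ → ℂ := fun θ => G (r * Complex.exp (θ * I)) with hu
  have hu_cont : Continuous u := continuous_comp_circle hG.continuousOn hr.le (by linarith)
  set s : ℝ → ℂ := fun θ => (starRingEnd ℂ) (u θ) / (‖u θ‖ : ℂ) with hs
  have hs_norm : ∀ θ, ‖s θ‖ ≤ 1 := by
    intro θ
    simp only [hs, norm_div, RCLike.norm_conj, Complex.norm_real, norm_norm]
    exact div_self_le_one _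
  have hs_mul : ∀ θ, s θ * u θ = (‖u θ‖ : ℂ) := by
    intro θ
    simp only [hs]
    by_cases h : u θ = 0
    · simp [h]
    · have h2 : (‖u θ‖ : ℂ) ≠ 0 := by exact_mod_cast norm_ne_zero_iff.2 h
      rw [div_mul_eq_mul_div, Complex.conj_mul', sq]
      field_simp
  have hs_meas : Measurable s :=
    (Complex.continuous_conj.comp hu_cont).measurable.div
      (Complex.continuous_ofReal.comp hu_cont.norm).measurable
  have hs_int : IntervalIntegrable s MeasureTheory.volume 0 (2 * Real.pi) := by
    refine (intervalIntegrable_const (c := (1 : ℝ))).mono_fun hs_meas.aestronglyMeasurable ?_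
    exact Eventually.of_forall fun θ => by simpa using hs_norm θ
  set H : ℂ → ℂ := fun w => ∫ θ in (0 : ℝ)..(2 * Real.pi), s θ * G (w * Complex.exp (θ * I))
    with hH
  have hmaps : MapsTo (fun p : ℂ × ℝ => p.1 * Complex.exp (p.2 * I))
      (Metric.ball 0 1 ×ˢ univ) (Metric.ball 0 1) := by
    rintro ⟨w, θ⟩ ⟨hw, -⟩
    simpa [Complex.norm_exp_ofReal_mul_I] using hw
  have hGd : DifferentiableOn ℂ (deriv G) (Metric.ball 0 1) := hG.deriv Metric.isOpen_ball
  have hHd : DifferentiableOn ℂ H (Metric.ball 0 1) := by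
    refine differentiableOn_integral_mul Metric.isOpen_ball hs_int
      (k := fun w θ => G (w * Complex.exp (θ * I)))
      (k' := fun w θ => deriv G (w * Complex.exp (θ * I)) * Complex.exp (θ * I)) ?_ ?_ ?_
    · exact hG.continuousOn.comp (f := fun p : ℂ × ℝ => p.1 * Complex.exp (p.2 * I))
        (by fun_prop) hmaps
    · exact (hGd.continuousOn.comp (f := fun p : ℂ × ℝ => p.1 * Complex.exp (p.2 * I))
        (by fun_prop) hmaps).mul (by fun_prop)
    · intro w hw θ
      have h1 : w * Complex.exp (θ * I) ∈ Metric.ball (0 : ℂ) 1 := hmaps (x := (w, θ)) ⟨hw, mem_univ _⟩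
      have h2 := (hG.differentiableAt (Metric.isOpen_ball.mem_nhds h1)).hasDerivAt
      have h3 : HasDerivAt (fun v : ℂ => v * Complex.exp (θ * I)) (Complex.exp (θ * I)) w := by
        simpa using (hasDerivAt_id w).mul_const (Complex.exp (θ * I))
      exact h2.comp w h3
  have hbound : ∀ z ∈ frontier (Metric.ball (0 : ℂ) r'),
      ‖H z‖ ≤ ∫ θ in (0 : ℝ)..(2 * Real.pi), ‖G (r' * Complex.exp (θ * I))‖ := by
    intro z hz
    rw [frontier_ball _ hr0'.ne', mem_sphere_zero_iff_norm] at hz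
    have hz2 : ∀ θ : ℝ, z * Complex.exp (θ * I) = r' * Complex.exp ((θ + z.arg : ℝ) * I) := by
      intro θ
      conv_lhs => rw [← Complex.norm_mul_exp_arg_mul_I z, hz]
      rw [mul_assoc, ← Complex.exp_add]
      congr 2; push_cast; ring
    have hper : Function.Periodic (fun θ : ℝ => ‖G (r' * Complex.exp (θ * I))‖) (2 * Real.pi) := by
      intro θ
      have : Complex.exp ((θ + 2 * Real.pi : ℝ) * I) = Complex.exp (θ * I) := by
        rw [← Complex.exp_periodic (θ * I)]; congr 1; push_cast; ring
      simp only [this]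
    have hc : Continuous fun θ : ℝ => ‖G (r' * Complex.exp (θ * I))‖ :=
      (continuous_comp_circle hG.continuousOn hr0'.le hr').norm
    calc ‖H z‖ ≤ ∫ θ in (0 : ℝ)..(2 * Real.pi),
          ‖G (r' * Complex.exp ((θ + z.arg : ℝ) * I))‖ := by
          refine intervalIntegral.norm_integral_le_of_norm_le (by positivity) ?_
            ((hc.comp (continuous_id.add continuous_const)).intervalIntegrable _ _)
          refine Eventually.of_forall fun θ _ => ?_
          rw [norm_mul, hz2]
          exact mul_le_of_le_one_left (norm_nonneg _) (hs_norm θ)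
      _ = _ := by
          rw [intervalIntegral.integral_comp_add_right
            (fun θ : ℝ => ‖G (r' * Complex.exp (θ * I))‖) z.arg]
          have := hper.intervalIntegral_add_eq z.arg 0
          rw [zero_add] at this ⊢
          rw [add_comm (2 * Real.pi)]
          exact this
  have hmax := Complex.norm_le_of_forall_mem_frontier_norm_le (z := (r : ℂ)) Metric.isBounded_ball
    (hHd.diffContOnCl_ball (Metric.closedBall_subset_ball hr')) hbound
    (by rw [closure_ball _ hr0'.ne']; simpa [abs_of_pos hr] using hrr')
  have hHr : H r = ((∫ θ in (0 : ℝ)..(2 * Real.pi), ‖u θ‖ : ℝ) : ℂ) := by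
    rw [← intervalIntegral.integral_ofReal]
    exact intervalIntegral.integral_congr fun θ _ => hs_mul θ
  rw [hHr, Complex.norm_real] at hmax
  exact (le_abs_self _).trans hmax

/-- The real coefficients of a matrix of `ℳ` that is neither the identity nor `(0 1; 1 1)`. -/
structure MoebiusData (a b c d : ℝ) : Prop where
  a_nonneg : 0 ≤ a
  a_le_c : a ≤ c
  b_pos : 0 < b
  b_lt_d : b < d
  c_pos : 0 < c
  c_le_d : c ≤ d
  det : (a * d - b * c) ^ 2 = 1

/-- The image under `L_g` of the Cauchy kernel `z ↦ (y - z)⁻¹`, in the disc variable. -/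
def moebiusKernel (a b c d : ℝ) (ω : ℂ) (y : ℝ) : ℂ :=
  ω / ((c * y + d) ^ 2 * ((a * y + b) * ω - (c * y + d) * (ω + 1) ^ 2 / 4))

/-- The function `L_g φ` in the disc variable, where `φ` corresponds to `f`. -/
def discOp (a b c d : ℝ) (f : ℂ → ℂ) (ω : ℂ) : ℂ := cutIntegral f (moebiusKernel a b c d ω)

namespace MoebiusData

variable {a b c d : ℝ} (hg : MoebiusData a b c d)
include hg

lemma d_pos : 0 < d := hg.b_pos.trans hg.b_lt_d

lemma denom_pos {y : ℝ} (hy : 0 ≤ y) : 0 < c * y + d := by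
  have := hg.c_pos; have := hg.d_pos; positivity

lemma d_le_denom {y : ℝ} (hy : 0 ≤ y) : d ≤ c * y + d := by
  nlinarith [hg.c_pos]

lemma ratio_mem {y : ℝ} (hy : y ∈ Icc (0 : ℝ) 1) : (a * y + b) / (c * y + d) ∈ Icc (0 : ℝ) 1 := by
  have h := hg.denom_pos hy.1
  have h1 := hg.a_nonneg
  have h2 := hg.b_pos
  have h3 := hy.1
  refine ⟨by positivity, (div_le_one h).2 ?_⟩
  nlinarith [mul_le_mul_of_nonneg_right hg.a_le_c hy.1, hg.b_lt_d]

lemma ne_ratio {z : ℂ} (hz : z ∈ cutPlane 0 1) {y : ℝ} (hy : y ∈ Icc (0 : ℝ) 1) :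
    (a * y + b : ℂ) - (c * y + d) * z ≠ 0 := by
  intro h
  refine hz ⟨_, hg.ratio_mem hy, ?_⟩
  have h1 : (c * y + d : ℂ) ≠ 0 := by exact_mod_cast (hg.denom_pos hy.1).ne'
  push_cast
  rw [div_eq_iff h1]
  linear_combination h

lemma sub_mul_ne_zero {z : ℂ} (hz : z ∈ cutPlane 0 1) : (a : ℂ) - c * z ≠ 0 := by
  intro h
  have hc := hg.c_pos
  refine hz ⟨a / c, ⟨div_nonneg hg.a_nonneg hc.le, (div_le_one hc).2 hg.a_le_c⟩, ?_⟩
  have h1 : (c : ℂ) ≠ 0 := by exact_mod_cast hc.ne'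
  push_cast
  rw [div_eq_iff h1]
  linear_combination h

lemma image_mem_cutPlane {z : ℂ} (hz : z ∈ cutPlane 0 1) :
    ((d : ℂ) * z - b) / (a - c * z) ∈ cutPlane 0 1 := by
  rintro ⟨y, hy, h⟩
  rw [eq_div_iff (hg.sub_mul_ne_zero hz)] at h
  exact hg.ne_ratio hz hy (by linear_combination h)

lemma pole_mem_cutPlane : -(d : ℂ) / c ∈ cutPlane 0 1 := by
  rintro ⟨y, hy, h⟩
  have h1 : y = -d / c := by exact_mod_cast h
  have h2 : 0 < d / c := div_pos hg.d_pos hg.c_pos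
  rw [neg_div] at h1
  linarith [hy.1]

lemma kernel_denom_ne_zero {ω : ℂ} (hω : ω ∈ Metric.ball (0 : ℂ) 1) {y : ℝ}
    (hy : y ∈ Icc (0 : ℝ) 1) :
    (c * y + d : ℂ) ^ 2 * ((a * y + b) * ω - (c * y + d) * (ω + 1) ^ 2 / 4) ≠ 0 := by
  have h1 : (c * y + d : ℂ) ≠ 0 := by exact_mod_cast (hg.denom_pos hy.1).ne'
  refine mul_ne_zero (pow_ne_zero _ h1) ?_
  rcases eq_or_ne ω 0 with rfl | h0
  · simpa using h1
  · have := hg.ne_ratio (joukowski_mem_cutPlane h0 (mem_ball_zero_iff.1 hω)) hy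
    have h2 : (a * y + b : ℂ) * ω - (c * y + d) * (ω + 1) ^ 2 / 4 =
        ω * (a * y + b - (c * y + d) * joukowski ω) := by
      unfold joukowski; field_simp
    rw [h2]
    exact mul_ne_zero h0 this

lemma differentiableOn_discOp {f : ℂ → ℂ} (hf : ContinuousOn f (Metric.closedBall 0 1)) :
    DifferentiableOn ℂ (discOp a b c d f) (Metric.ball 0 1) := by
  unfold discOp cutIntegral
  refine DifferentiableOn.const_mul ?_ _
  have hD : ∀ p ∈ Metric.ball (0 : ℂ) 1 ×ˢ (univ : Set ℝ),
      (c * (segPoint p.2 : ℝ) + d : ℂ) ^ 2 * ((a * (segPoint p.2 : ℝ) + b) * p.1 -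
        (c * (segPoint p.2 : ℝ) + d) * (p.1 + 1) ^ 2 / 4) ≠ 0 := fun p hp =>
    hg.kernel_denom_ne_zero hp.1 (segPoint_mem_Icc p.2)
  have hsc := continuous_segPoint
  refine differentiableOn_integral_mul Metric.isOpen_ball
    (((continuous_comp_exp hf).mul (by fun_prop)).intervalIntegrable _ _)
    (k := fun ω θ => moebiusKernel a b c d ω (segPoint θ))
    (k' := fun ω θ => (1 * ((c * (segPoint θ : ℝ) + d : ℂ) ^ 2 * ((a * (segPoint θ : ℝ) + b) * ω -
        (c * (segPoint θ : ℝ) + d) * (ω + 1) ^ 2 / 4)) -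
        ω * ((c * (segPoint θ : ℝ) + d : ℂ) ^ 2 * ((a * (segPoint θ : ℝ) + b) * 1 -
        (c * (segPoint θ : ℝ) + d) * (2 * (ω + 1)) / 4))) /
        ((c * (segPoint θ : ℝ) + d : ℂ) ^ 2 * ((a * (segPoint θ : ℝ) + b) * ω -
        (c * (segPoint θ : ℝ) + d) * (ω + 1) ^ 2 / 4)) ^ 2) ?_ ?_ ?_
  · exact ContinuousOn.div (by fun_prop) (by fun_prop) hD
  · exact ContinuousOn.div (by fun_prop) (by fun_prop) fun p hp => pow_ne_zero 2 (hD p hp)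
  · intro ω hω θ
    refine HasDerivAt.div (hasDerivAt_id ω) ?_ (hD (ω, θ) ⟨hω, mem_univ _⟩)
    refine HasDerivAt.const_mul _ (HasDerivAt.sub ((hasDerivAt_id ω).const_mul _) ?_)
    refine (HasDerivAt.const_mul _ ?_).div_const _
    simpa using ((hasDerivAt_id' ω).add_const 1).fun_pow 2

lemma moebiusKernel_eq {ω : ℂ} (h0 : ω ≠ 0) (hω : ‖ω‖ < 1) {y : ℝ} (hy : y ∈ Icc (0 : ℝ) 1) :
    moebiusKernel a b c d ω y =
      (a - c * joukowski ω) * ((y - (d * joukowski ω - b) / (a - c * joukowski ω))⁻¹ -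
        (y - -(d : ℂ) / c)⁻¹) - (a * d - b * c) / c * ((y - -(d : ℂ) / c) ^ 2)⁻¹ := by
  have hz := joukowski_mem_cutPlane h0 hω
  have h1 : (c * y + d : ℂ) ≠ 0 := by exact_mod_cast (hg.denom_pos hy.1).ne'
  have h2 := hg.ne_ratio hz hy
  have h3 := hg.sub_mul_ne_zero hz
  have hc : (c : ℂ) ≠ 0 := by exact_mod_cast hg.c_pos.ne'
  have hdet : (a * d - b * c : ℂ) ^ 2 = 1 := by exact_mod_cast hg.det
  have h4 : moebiusKernel a b c d ω y =
      1 / ((c * y + d) ^ 2 * (a * y + b - (c * y + d) * joukowski ω)) := by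
    have h5 : (a * y + b : ℂ) * ω - (c * y + d) * (ω + 1) ^ 2 / 4 =
        ω * (a * y + b - (c * y + d) * joukowski ω) := by
      unfold joukowski; field_simp
    unfold moebiusKernel
    rw [h5]
    field_simp
  rw [h4]
  generalize joukowski ω = z at *
  have h6 : (y : ℂ) - (d * z - b) / (a - c * z) = (a * y + b - (c * y + d) * z) / (a - c * z) := by
    rw [eq_div_iff h3, sub_mul, div_mul_cancel₀ _ h3]; ring
  have h7 : (y : ℂ) - -(d : ℂ) / c = (c * y + d) / c := by field_simp; ring
  have h8 : (a - c * z) * (c * y + d) - c * (a * y + b - (c * y + d) * z) = a * d - b * c := by ring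
  rw [h6, h7, ← h8]
  rw [← h8] at hdet
  generalize (a : ℂ) * y + b - (c * y + d) * z = v at *
  generalize (c : ℂ) * y + d = u at *
  generalize (a : ℂ) - c * z = s at *
  field_simp
  linear_combination (-1 : ℂ) * hdet

end MoebiusData

lemma continuousOn_cauchyKernel {z : ℂ} (hz : z ∈ cutPlane 0 1) :
    ContinuousOn (fun y : ℝ => ((y : ℂ) - z)⁻¹) (Icc 0 1) := by
  refine ContinuousOn.inv₀ (by fun_prop) fun y hy h => hz ⟨y, hy, sub_eq_zero.1 h⟩

namespace MoebiusData

variable {a b c d : ℝ} (hg : MoebiusData a b c d)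
include hg

lemma discOp_eq {f : ℂ → ℂ} (hf : ContinuousOn f (Metric.closedBall 0 1)) {ω : ℂ} (h0 : ω ≠ 0)
    (hω : ‖ω‖ < 1) :
    discOp a b c d f ω =
      (a - c * joukowski ω) *
        (cutIntegral f (fun y => (y - (d * joukowski ω - b) / (a - c * joukowski ω))⁻¹) -
          cutIntegral f (fun y => (y - -(d : ℂ) / c)⁻¹)) -
        (a * d - b * c) / c * cutIntegral f (fun y => ((y - -(d : ℂ) / c) ^ 2)⁻¹) := by
  have hz := joukowski_mem_cutPlane h0 hω
  have hk1 := continuousOn_cauchyKernel (hg.image_mem_cutPlane hz)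
  have hk2 := continuousOn_cauchyKernel hg.pole_mem_cutPlane
  have hk3 : ContinuousOn (fun y : ℝ => ((y - -(d : ℂ) / c) ^ 2)⁻¹) (Icc 0 1) := by
    simpa only [inv_pow] using hk2.fun_pow 2
  unfold discOp
  rw [cutIntegral_congr fun y hy => hg.moebiusKernel_eq h0 hω hy,
    cutIntegral_sub hf (continuousOn_const.fun_mul (hk1.fun_sub hk2)) (continuousOn_const.fun_mul hk3),
    cutIntegral_const_mul, cutIntegral_const_mul, cutIntegral_sub hf hk1 hk2]

lemma norm_discOp_le_off_image {f : ℂ → ℂ} (hf : ContinuousOn f (Metric.closedBall 0 1)) {ω : ℂ}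
    (h0 : ω ≠ 0)
    (hpos : 0 < (d * (joukowski ω).re - b) * ((c + d) * (joukowski ω).re - (a + b))) :
    ‖discOp a b c d f ω‖ ≤
      (2 * d ^ 2 * √((d * (joukowski ω).re - b) * ((c + d) * (joukowski ω).re - (a + b))))⁻¹ *
        circleMean f := by
  refine norm_cutIntegral_le hf fun y hy => ?_
  have h5 : (a * y + b : ℂ) * ω - (c * y + d) * (ω + 1) ^ 2 / 4 =
      ω * (a * y + b - (c * y + d) * joukowski ω) := by
    unfold joukowski; field_simp
  have hy0 := hy.1
  have hy1 : 0 ≤ 1 - y := by linarith [hy.2]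
  have hd := hg.d_pos
  have hD := hg.denom_pos hy.1
  have hdD := hg.d_le_denom hy.1
  set x := (joukowski ω).re with hx
  set α := d * x - b with hα
  set β := (c + d) * x - (a + b) with hβ
  have hl : α * (1 - y) + β * y = -(a * y + b - (c * y + d) * x) := by rw [hα, hβ]; ring
  set l := α * (1 - y) + β * y with hldef
  have hl2 : 4 * (α * β) * (y * (1 - y)) ≤ l ^ 2 := by
    nlinarith [sq_nonneg (α * (1 - y) - β * y)]
  have hl_ne : l ≠ 0 := by
    intro h
    have h7 : α * β * ((1 - y) ^ 2 + y ^ 2) + y * (1 - y) * (α ^ 2 + β ^ 2) =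
      l * (β * (1 - y) + α * y) := by rw [hldef]; ring
    have h8 : 0 < (1 - y) ^ 2 + y ^ 2 := by nlinarith [sq_nonneg (1 - 2 * y)]
    have h9 := mul_pos hpos h8
    have h10 : 0 ≤ y * (1 - y) * (α ^ 2 + β ^ 2) := by positivity
    rw [h, zero_mul] at h7
    linarith
  have hre : |l| ≤ ‖(a * y + b : ℂ) - (c * y + d) * joukowski ω‖ := by
    refine le_trans (le_of_eq ?_) (Complex.abs_re_le_norm _)
    rw [hl, abs_neg, hx]
    congr 1
    have h6 : (a * y + b : ℂ) - (c * y + d) * joukowski ω =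
      ((a * y + b : ℝ) : ℂ) - ((c * y + d : ℝ) : ℂ) * joukowski ω := by push_cast; ring
    rw [h6, Complex.sub_re, Complex.re_ofReal_mul, Complex.ofReal_re]
  have hDn : ‖(c * y + d : ℂ)‖ = c * y + d := by
    have : (c * y + d : ℂ) = ((c * y + d : ℝ) : ℂ) := by push_cast; ring
    rw [this, Complex.norm_real, Real.norm_of_nonneg hD.le]
  have habs : 0 < |l| := abs_pos.2 hl_ne
  have hk : ‖moebiusKernel a b c d ω y‖ ≤ (d ^ 2 * |l|)⁻¹ := by
    unfold moebiusKernel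
    rw [h5, norm_div, norm_mul, norm_mul, norm_pow, hDn, mul_left_comm,
      div_mul_cancel_left₀ (norm_ne_zero_iff.2 h0)]
    gcongr
  have hs : √(y * (1 - y)) * (2 * √(α * β)) ≤ |l| := by
    rw [← Real.sqrt_sq_eq_abs]
    refine Real.le_sqrt_of_sq_le ?_
    rw [mul_pow, mul_pow, Real.sq_sqrt (by positivity), Real.sq_sqrt hpos.le]
    linarith
  have hsp : 0 < √(α * β) := Real.sqrt_pos.2 hpos
  calc √(y * (1 - y)) * ‖moebiusKernel a b c d ω y‖
      ≤ √(y * (1 - y)) * (d ^ 2 * |l|)⁻¹ := by gcongr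
    _ ≤ _ := by
      rw [← div_eq_mul_inv, inv_eq_one_div, div_le_div_iff₀ (by positivity) (by positivity)]
      nlinarith [mul_le_mul_of_nonneg_left hs (sq_nonneg d)]

lemma sqrt_mul_inv_sub_pole_le {y : ℝ} (hy : y ∈ Icc (0 : ℝ) 1) :
    √(y * (1 - y)) ≤ 1 / 2 ∧ ‖((y : ℂ) - -(d : ℂ) / c)⁻¹‖ ≤ c / d := by
  constructor
  · rw [Real.sqrt_le_left (by norm_num)]
    nlinarith [sq_nonneg (y - 1 / 2)]
  · have hc := hg.c_pos
    have hd := hg.d_pos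
    have h1 : (y : ℂ) - -(d : ℂ) / c = ((y + d / c : ℝ) : ℂ) := by push_cast; ring
    have h2 : 0 < d / c := by positivity
    have h3 : 0 < y + d / c := by linarith [hy.1]
    rw [h1, norm_inv, Complex.norm_real, Real.norm_of_nonneg h3.le, ← inv_div d c]
    exact inv_anti₀ h2 (by linarith [hy.1])

lemma norm_cutIntegral_pole_le {f : ℂ → ℂ} (hf : ContinuousOn f (Metric.closedBall 0 1)) :
    ‖cutIntegral f (fun y => (y - -(d : ℂ) / c)⁻¹)‖ ≤ 1 / 2 * circleMean f := by
  refine norm_cutIntegral_le hf fun y hy => ?_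
  obtain ⟨h1, h2⟩ := hg.sqrt_mul_inv_sub_pole_le hy
  have h3 : c / d ≤ 1 := (div_le_one hg.d_pos).2 hg.c_le_d
  calc _ ≤ (1 / 2 : ℝ) * 1 := by gcongr; exact h2.trans h3
    _ = 1 / 2 := by norm_num

lemma norm_cutIntegral_pole_sq_le {f : ℂ → ℂ} (hf : ContinuousOn f (Metric.closedBall 0 1)) :
    ‖((a * d - b * c : ℂ)) / c * cutIntegral f (fun y => ((y - -(d : ℂ) / c) ^ 2)⁻¹)‖ ≤
      1 / (2 * d) * circleMean f := by
  have hc := hg.c_pos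
  have hd := hg.d_pos
  have hdet : ‖(a * d - b * c : ℂ)‖ = 1 := by
    have : (a * d - b * c : ℂ) = ((a * d - b * c : ℝ) : ℂ) := by push_cast; ring
    rw [this, Complex.norm_real, Real.norm_eq_abs, ← sq_eq_sq₀ (abs_nonneg _) zero_le_one, sq_abs,
      hg.det, one_pow]
  have h4 : ‖cutIntegral f (fun y => ((y - -(d : ℂ) / c) ^ 2)⁻¹)‖ ≤
      1 / 2 * (c / d) ^ 2 * circleMean f := by
    refine norm_cutIntegral_le hf fun y hy => ?_
    obtain ⟨h1, h2⟩ := hg.sqrt_mul_inv_sub_pole_le hy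
    rw [← inv_pow, norm_pow]
    gcongr
  rw [norm_mul, norm_div, hdet, Complex.norm_real, Real.norm_of_nonneg hc.le]
  calc _ ≤ 1 / c * (1 / 2 * (c / d) ^ 2 * circleMean f) := by gcongr
    _ = (c / d) * (1 / (2 * d) * circleMean f) := by field_simp
    _ ≤ _ := by
      refine mul_le_of_le_one_left (mul_nonneg (by positivity) circleMean_nonneg) ?_
      exact (div_le_one hd).2 hg.c_le_d

lemma norm_discOp_le {f : ℂ → ℂ} (hf : ContinuousOn f (Metric.closedBall 0 1)) {ω : ℂ} (h0 : ω ≠ 0)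
    (hω : ‖ω‖ < 1) :
    ‖discOp a b c d f ω‖ ≤ ‖(a : ℂ) - c * joukowski ω‖ *
        (‖cutIntegral f (fun y => (y - (d * joukowski ω - b) / (a - c * joukowski ω))⁻¹)‖ +
          1 / 2 * circleMean f) + 1 / (2 * d) * circleMean f := by
  rw [hg.discOp_eq hf h0 hω]
  refine (norm_sub_le _ _).trans (add_le_add ?_ (hg.norm_cutIntegral_pole_sq_le hf))
  rw [norm_mul]
  refine mul_le_mul_of_nonneg_left ?_ (norm_nonneg _)
  exact (norm_sub_le _ _).trans (add_le_add le_rfl (hg.norm_cutIntegral_pole_le hf))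

end MoebiusData

/-- The circle means of a holomorphic function are bounded by any integral of its boundary
upper limits. -/
lemma lintegral_circle_le_of_eventually {G : ℂ → ℂ} (hG : DifferentiableOn ℂ G (Metric.ball 0 1))
    {C : ℝ} (hC : ∀ ω : ℂ, 1 / 2 ≤ ‖ω‖ → ‖ω‖ < 1 → ‖G ω‖ ≤ C) {B : ℝ → ℝ}
    (hB : ∀ᵐ θ : ℝ ∂MeasureTheory.volume.restrict (Ioc (0 : ℝ) (2 * Real.pi)), ∀ ε > 0,
      ∀ᶠ r : ℝ in 𝓝[<] 1, ‖G (r * Complex.exp (θ * I))‖ ≤ B θ + ε)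
    {r : ℝ} (hr : 0 < r) (hr1 : r < 1) :
    ∫⁻ θ in Ioc (0 : ℝ) (2 * Real.pi), ‖G (r * Complex.exp (θ * I))‖ₑ ≤
      ∫⁻ θ in Ioc (0 : ℝ) (2 * Real.pi), ENNReal.ofReal (B θ) := by
  have hcont : ∀ s : ℝ, 0 < s → s < 1 → Continuous fun θ : ℝ => G (s * Complex.exp (θ * I)) :=
    fun s hs hs1 => continuous_comp_circle hG.continuousOn hs.le hs1
  have hpi : (0 : ℝ) ≤ 2 * Real.pi := by positivity
  have hlint : ∀ s : ℝ, 0 < s → s < 1 →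
      ∫⁻ θ in Ioc (0 : ℝ) (2 * Real.pi), ‖G (s * Complex.exp (θ * I))‖ₑ =
        ENNReal.ofReal (∫ θ in (0 : ℝ)..(2 * Real.pi), ‖G (s * Complex.exp (θ * I))‖) := by
    intro s hs hs1
    rw [intervalIntegral.integral_of_le hpi,
      MeasureTheory.ofReal_integral_norm_eq_lintegral_enorm]
    exact ((hcont s hs hs1).intervalIntegrable _ _).1
  obtain ⟨u, -, hu, hlim⟩ := exists_seq_strictMono_tendsto' (max_lt hr1 (by norm_num : (1 / 2 : ℝ) < 1))
  have hu0 : ∀ n, 0 < u n ∧ u n < 1 ∧ r ≤ u n ∧ 1 / 2 ≤ u n := fun n => by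
    obtain ⟨h1, h2⟩ := hu n
    obtain ⟨h3, h4⟩ := max_lt_iff.1 h1
    exact ⟨hr.trans h3, h2, h3.le, h4.le⟩
  have hlim' : Tendsto u atTop (𝓝[<] 1) :=
    tendsto_nhdsWithin_iff.2 ⟨hlim, Eventually.of_forall fun n => (hu0 n).2.1⟩
  have hmono : ∀ n, ∫⁻ θ in Ioc (0 : ℝ) (2 * Real.pi), ‖G (r * Complex.exp (θ * I))‖ₑ ≤
      ∫⁻ θ in Ioc (0 : ℝ) (2 * Real.pi), ‖G (u n * Complex.exp (θ * I))‖ₑ := by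
    intro n
    obtain ⟨h1, h2, h3, -⟩ := hu0 n
    rw [hlint r hr hr1, hlint _ h1 h2]
    exact ENNReal.ofReal_le_ofReal (integral_norm_circle_mono hG hr h3 h2)
  refine (le_limsup_of_frequently_le (f := atTop) (Frequently.of_forall hmono)
    (by isBoundedDefault)).trans ?_
  refine (MeasureTheory.limsup_lintegral_le (fun _ => ENNReal.ofReal C) ?_ ?_ ?_).trans ?_
  · exact fun n => (hcont _ (hu0 n).1 (hu0 n).2.1).enorm.measurable
  · refine fun n => Eventually.of_forall fun θ => ?_
    dsimp only
    rw [← ofReal_norm]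
    refine ENNReal.ofReal_le_ofReal (hC _ ?_ ?_) <;> rw [norm_ofReal_mul_exp (hu0 n).1.le]
    exacts [(hu0 n).2.2.2, (hu0 n).2.1]
  · simp [ENNReal.mul_eq_top]
  · refine MeasureTheory.lintegral_mono_ae ?_
    filter_upwards [hB] with θ hθ
    refine ENNReal.le_of_forall_pos_le_add fun ε hε _ => ?_
    refine limsup_le_of_le (by isBoundedDefault) ?_
    filter_upwards [hlim'.eventually (hθ ε hε)] with n hn
    rw [← ofReal_norm, ← ENNReal.ofReal_coe_nnreal]
    exact (ENNReal.ofReal_le_ofReal hn).trans ENNReal.ofReal_add_le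

lemma tendsto_joukowski_radial (θ : ℝ) :
    Tendsto (fun r : ℝ => joukowski (r * Complex.exp (θ * I))) (𝓝[<] 1) (𝓝 (segPoint θ : ℝ)) := by
  have : ContinuousAt (fun r : ℝ => joukowski (r * Complex.exp (θ * I))) 1 := by
    unfold joukowski
    refine ContinuousAt.div (by fun_prop) (by fun_prop) ?_
    simp [Complex.exp_ne_zero]
  rw [ofReal_segPoint]
  have h := this.tendsto.mono_left (nhdsWithin_le_nhds (s := Iio 1))
  simpa using h

lemma norm_le_of_joukowski_near {f : ℂ → ℂ} (hf : ContinuousOn f (Metric.closedBall 0 1)) (τ : ℝ)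
    {ε : ℝ} (hε : 0 < ε) :
    ∃ δ > 0, ∀ w : ℂ, w ≠ 0 → ‖w‖ < 1 → ‖joukowski w - segPoint τ‖ < δ →
      ‖f w‖ ≤ ‖f (Complex.exp (τ * I))‖ + ‖f (Complex.exp (-τ * I))‖ + ε := by
  have key : ∀ σ : ℝ, ∃ δ > 0, ∀ w : ℂ, ‖w‖ < 1 → ‖w - Complex.exp (σ * I)‖ < δ →
      ‖f w‖ ≤ ‖f (Complex.exp (σ * I))‖ + ε := by
    intro σ
    have h := Metric.continuousOn_iff.1 hf (Complex.exp (σ * I))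
      (by simp [Complex.norm_exp_ofReal_mul_I]) ε hε
    obtain ⟨δ, hδ, h⟩ := h
    refine ⟨δ, hδ, fun w hw hd => ?_⟩
    have h1 := h w (by simpa using hw.le) (by rwa [dist_eq_norm])
    rw [dist_eq_norm] at h1
    linarith [norm_le_norm_add_norm_sub' (f w) (f (Complex.exp (σ * I)))]
  obtain ⟨δ₁, hδ₁, h₁⟩ := key τ
  obtain ⟨δ₂, hδ₂, h₂⟩ := key (-τ)
  rw [Complex.ofReal_neg] at h₂
  refine ⟨δ₁ * δ₂ / 4, by positivity, fun w hw0 hw hd => ?_⟩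
  have h3 := congrArg norm (sub_exp_mul_sub_exp hw0 τ)
  rw [norm_mul, norm_mul, norm_mul] at h3
  have h4 : ‖w - Complex.exp (τ * I)‖ * ‖w - Complex.exp (-τ * I)‖ < δ₁ * δ₂ := by
    rw [h3]
    have h5 : ‖(4 : ℂ)‖ * ‖w‖ ≤ 4 := by
      rw [show ‖(4 : ℂ)‖ = 4 by norm_num]; linarith
    calc _ ≤ 4 * ‖joukowski w - segPoint τ‖ := by gcongr
      _ < _ := by linarith
  rcases lt_or_ge ‖w - Complex.exp (τ * I)‖ δ₁ with h | h
  · linarith [h₁ w hw h, norm_nonneg (f (Complex.exp (-τ * I)))]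
  · have : ‖w - Complex.exp (-τ * I)‖ < δ₂ := by
      by_contra! h'
      exact absurd h4 (not_lt.2 (mul_le_mul h h' hδ₂.le (norm_nonneg _)))
    linarith [h₂ w hw this, norm_nonneg (f (Complex.exp (τ * I)))]

namespace MoebiusData

variable {a b c d : ℝ} (hg : MoebiusData a b c d)
include hg

lemma eventually_norm_discOp_le_off_image {f : ℂ → ℂ}
    (hf : ContinuousOn f (Metric.closedBall 0 1)) {θ : ℝ}
    (hpos : 0 < (d * segPoint θ - b) * ((c + d) * segPoint θ - (a + b))) {ε : ℝ} (hε : 0 < ε) :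
    ∀ᶠ r : ℝ in 𝓝[<] 1, ‖discOp a b c d f (r * Complex.exp (θ * I))‖ ≤
      (2 * d ^ 2 * √((d * segPoint θ - b) * ((c + d) * segPoint θ - (a + b))))⁻¹ *
        circleMean f + ε := by
  have hx : Tendsto (fun r : ℝ => (joukowski (r * Complex.exp (θ * I))).re) (𝓝[<] 1)
      (𝓝 (segPoint θ)) := by
    simpa [Function.comp_def] using
      (Complex.continuous_re.tendsto _).comp (tendsto_joukowski_radial θ)
  have hd := hg.d_pos
  have hcont : ContinuousAt (fun x : ℝ =>
      (2 * d ^ 2 * √((d * x - b) * ((c + d) * x - (a + b))))⁻¹ * circleMean f) (segPoint θ) := by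
    refine ContinuousAt.mul (ContinuousAt.inv₀ (by fun_prop) ?_) (by fun_prop)
    have := Real.sqrt_pos.2 hpos
    positivity
  have hcont' : ContinuousAt (fun x : ℝ => (d * x - b) * ((c + d) * x - (a + b))) (segPoint θ) := by
    fun_prop
  filter_upwards [hx.eventually (hcont.tendsto.eventually_le_const (lt_add_of_pos_right _ hε)),
    hx.eventually (hcont'.tendsto.eventually_const_lt hpos), Ioo_mem_nhdsLT zero_lt_one]
    with r h1 h2 h3
  refine (hg.norm_discOp_le_off_image hf ?_ h2).trans h1
  have : (r : ℂ) ≠ 0 := by exact_mod_cast h3.1.ne'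
  exact mul_ne_zero this (Complex.exp_ne_zero _)

/-- The Cauchy transform of `f` at a point off the segment is a value of `f`. -/
lemma exists_cutIntegral_image_eq {f : ℂ → ℂ} {ρ : ℝ} (hρ : 1 < ρ)
    (hf : DifferentiableOn ℂ f (Metric.ball 0 ρ)) (hf0 : f 0 = 0) {ω : ℂ} (h0 : ω ≠ 0)
    (hω : ‖ω‖ < 1) :
    ∃ w : ℂ, w ≠ 0 ∧ ‖w‖ < 1 ∧
      joukowski w = (d * joukowski ω - b) / (a - c * joukowski ω) ∧
      cutIntegral f (fun y => (y - (d * joukowski ω - b) / (a - c * joukowski ω))⁻¹) = f w := by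
  obtain ⟨w, hw0, hw1, hw⟩ :=
    exists_joukowski_eq (hg.image_mem_cutPlane (joukowski_mem_cutPlane h0 hω))
  refine ⟨w, hw0, hw1, hw, ?_⟩
  rw [← hw]
  exact cutIntegral_cauchy hρ hf hf0 hw0 hw1

lemma exists_norm_discOp_le {f : ℂ → ℂ} {ρ : ℝ} (hρ : 1 < ρ)
    (hf : DifferentiableOn ℂ f (Metric.ball 0 ρ)) (hf0 : f 0 = 0) :
    ∃ C, ∀ ω : ℂ, 1 / 2 ≤ ‖ω‖ → ‖ω‖ < 1 → ‖discOp a b c d f ω‖ ≤ C := by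
  have hfc : ContinuousOn f (Metric.closedBall 0 1) :=
    hf.continuousOn.mono (Metric.closedBall_subset_ball hρ)
  obtain ⟨M, hM⟩ := (isCompact_closedBall (0 : ℂ) 1).exists_bound_of_continuousOn hfc
  refine ⟨(a + c * 2) * (M + 1 / 2 * circleMean f) + 1 / (2 * d) * circleMean f,
    fun ω hω hω1 => ?_⟩
  have h0 : ω ≠ 0 := by rintro rfl; norm_num at hω
  obtain ⟨w, -, hw1, -, hw⟩ := hg.exists_cutIntegral_image_eq hρ hf hf0 h0 hω1
  have h1 := hg.norm_discOp_le hfc h0 hω1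
  have hmean : 0 ≤ circleMean f := circleMean_nonneg
  have h2 : ‖f w‖ ≤ M := hM w (by simpa using hw1.le)
  rw [hw] at h1
  have hj : ‖joukowski ω‖ ≤ 2 := by
    unfold joukowski
    rw [norm_div, norm_pow, norm_mul, show ‖(4 : ℂ)‖ = 4 by norm_num, div_le_iff₀ (by linarith)]
    have h3 : ‖ω + 1‖ ≤ 2 := (norm_add_le _ _).trans (by rw [norm_one]; linarith)
    nlinarith [norm_nonneg (ω + 1)]
  have h3 : ‖(a : ℂ) - c * joukowski ω‖ ≤ a + c * 2 := by
    refine (norm_sub_le _ _).trans ?_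
    rw [norm_mul, Complex.norm_real, Complex.norm_real, Real.norm_of_nonneg hg.a_nonneg,
      Real.norm_of_nonneg hg.c_pos.le]
    have := hg.c_pos
    gcongr
  have h4 : 0 ≤ a + c * 2 := (norm_nonneg _).trans h3
  refine h1.trans ?_
  gcongr

lemma eventually_norm_discOp_le_image {f : ℂ → ℂ} {ρ : ℝ} (hρ : 1 < ρ)
    (hf : DifferentiableOn ℂ f (Metric.ball 0 ρ)) (hf0 : f 0 = 0) {θ τ : ℝ}
    (hθ : segPoint θ = (a * segPoint τ + b) / (c * segPoint τ + d)) {ε : ℝ} (hε : 0 < ε) :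
    ∀ᶠ r : ℝ in 𝓝[<] 1, ‖discOp a b c d f (r * Complex.exp (θ * I))‖ ≤
      d⁻¹ * (‖f (Complex.exp (τ * I))‖ + ‖f (Complex.exp (-τ * I))‖ + circleMean f) + ε := by
  have hfc : ContinuousOn f (Metric.closedBall 0 1) :=
    hf.continuousOn.mono (Metric.closedBall_subset_ball hρ)
  have hd := hg.d_pos
  have hmean : 0 ≤ circleMean f := circleMean_nonneg
  have hD := hg.denom_pos (segPoint_mem_Icc τ).1
  have hdD := hg.d_le_denom (segPoint_mem_Icc τ).1
  set y := segPoint τ with hy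
  set S := ‖f (Complex.exp (τ * I))‖ + ‖f (Complex.exp (-τ * I))‖ with hS
  have hx : (a - c * segPoint θ) = (a * d - b * c) / (c * y + d) := by
    rw [hθ, eq_div_iff hD.ne', sub_mul, mul_assoc, div_mul_cancel₀ _ hD.ne']; ring
  have hdet : |a * d - b * c| = 1 := by
    rw [← sq_eq_sq₀ (abs_nonneg _) zero_le_one, sq_abs, hg.det, one_pow]
  have hne : a - c * segPoint θ ≠ 0 := by
    rw [← abs_pos, hx, abs_div, hdet]; positivity
  have hneC : (a : ℂ) - c * (segPoint θ : ℝ) ≠ 0 := by exact_mod_cast hne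
  have hnorm : ‖(a : ℂ) - c * (segPoint θ : ℝ)‖ ≤ d⁻¹ := by
    have : (a : ℂ) - c * (segPoint θ : ℝ) = ((a - c * segPoint θ : ℝ) : ℂ) := by push_cast; ring
    rw [this, Complex.norm_real, Real.norm_eq_abs, hx, abs_div, hdet, abs_of_pos hD, one_div]
    exact inv_anti₀ hd hdD
  obtain ⟨δ, hδ, hnear⟩ := norm_le_of_joukowski_near hfc τ (ε := d * (ε / 2)) (by positivity)
  have hJ := tendsto_joukowski_radial θ
  have him : ContinuousAt (fun z : ℂ => (d * z - b) / (a - c * z)) (segPoint θ : ℝ) :=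
    ContinuousAt.div (by fun_prop) (by fun_prop) hneC
  have himv : ((d : ℂ) * (segPoint θ : ℝ) - b) / (a - c * (segPoint θ : ℝ)) = (y : ℝ) := by
    rw [div_eq_iff hneC]
    have h1 : (c * y + d) * segPoint θ = a * y + b := by rw [hθ, mul_div_cancel₀ _ hD.ne']
    have h2 : ((c : ℂ) * y + d) * (segPoint θ : ℝ) = a * y + b := by exact_mod_cast h1
    linear_combination h2
  have h1 := (him.tendsto.comp hJ)
  rw [himv] at h1
  have h2 := h1.eventually (Metric.ball_mem_nhds _ hδ)
  have h3 : Tendsto (fun r : ℝ => ‖(a : ℂ) - c * joukowski (r * Complex.exp (θ * I))‖ *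
      (S + d * (ε / 2) + 1 / 2 * circleMean f) + 1 / (2 * d) * circleMean f) (𝓝[<] 1)
      (𝓝 (‖(a : ℂ) - c * (segPoint θ : ℝ)‖ *
      (S + d * (ε / 2) + 1 / 2 * circleMean f) + 1 / (2 * d) * circleMean f)) :=
    (((tendsto_const_nhds.sub (tendsto_const_nhds.mul hJ)).norm).mul_const _).add_const _
  have hS0 : 0 ≤ S := by positivity
  have h4 : ‖(a : ℂ) - c * (segPoint θ : ℝ)‖ *
      (S + d * (ε / 2) + 1 / 2 * circleMean f) + 1 / (2 * d) * circleMean f <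
      d⁻¹ * (S + circleMean f) + ε := by
    calc _ ≤ d⁻¹ * (S + d * (ε / 2) + 1 / 2 * circleMean f) + 1 / (2 * d) * circleMean f := by
          gcongr
      _ = d⁻¹ * (S + circleMean f) + ε / 2 := by field_simp; ring
      _ < _ := by linarith
  filter_upwards [h2, h3.eventually_le_const h4, Ioo_mem_nhdsLT zero_lt_one] with r h5 h6 h7
  have hr0 : (r : ℂ) ≠ 0 := by exact_mod_cast h7.1.ne'
  have h0 := mul_ne_zero hr0 (Complex.exp_ne_zero (θ * I))
  have hω : ‖r * Complex.exp (θ * I)‖ < 1 := by rw [norm_ofReal_mul_exp h7.1.le]; exact h7.2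
  obtain ⟨w, hw0, hw1, hwJ, hw⟩ := hg.exists_cutIntegral_image_eq hρ hf hf0 h0 hω
  refine (hg.norm_discOp_le hfc h0 hω).trans (le_trans ?_ h6)
  rw [hw]
  have h8 : ‖f w‖ ≤ S + d * (ε / 2) := by
    refine hnear w hw0 hw1 ?_
    rw [hwJ]
    simpa [dist_eq_norm] using h5
  gcongr

end MoebiusData

lemma lintegral_comp_segPoint (Φ : ℝ → ℝ≥0∞) :
    ∫⁻ θ in Ioc (0 : ℝ) (2 * Real.pi), Φ (segPoint θ) =
      2 * ∫⁻ θ in Ioo (0 : ℝ) Real.pi, Φ (segPoint θ) := by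
  have hpi := Real.pi_pos
  have h1 : Ioc (0 : ℝ) (2 * Real.pi) = Ioc 0 Real.pi ∪ Ioc Real.pi (2 * Real.pi) :=
    (Ioc_union_Ioc_eq_Ioc hpi.le (by linarith)).symm
  have h2 : Ioo Real.pi (2 * Real.pi) = (fun θ => 2 * Real.pi - θ) '' Ioo 0 Real.pi := by
    rw [image_const_sub_Ioo]; congr 1 <;> ring
  rw [h1, MeasureTheory.lintegral_union measurableSet_Ioc
    (disjoint_left.2 fun x h h' => h'.1.not_ge h.2),
    ← MeasureTheory.restrict_Ioo_eq_restrict_Ioc, ← MeasureTheory.restrict_Ioo_eq_restrict_Ioc, h2,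
    MeasureTheory.lintegral_image_eq_lintegral_abs_deriv_mul (f' := fun _ => -1) measurableSet_Ioo
      (fun x _ => ((hasDerivAt_id' x).const_sub _).hasDerivWithinAt)
      (fun x _ y _ h => by simpa using h), two_mul (MeasureTheory.lintegral _ _)]
  congr 1
  refine MeasureTheory.lintegral_congr fun θ => ?_
  unfold segPoint
  rw [Real.cos_two_pi_sub]
  simp

lemma hasDerivAt_arsinh_sqrt {κ η t : ℝ} (hκ : 0 < κ) (hη : 0 < η) (ht : 0 < t) :
    HasDerivAt (fun t => 2 / κ * Real.arsinh √(κ * t / η)) (√(κ * t * (κ * t + η)))⁻¹ t := by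
  have hu : 0 < κ * t / η := by positivity
  have h1 : HasDerivAt (fun t => κ * t / η) (κ / η) t := by
    simpa using ((hasDerivAt_id' t).const_mul κ).div_const η
  refine (((h1.sqrt hu.ne').arsinh).const_mul (2 / κ)).congr_deriv ?_
  have h2 : κ * t * (κ * t + η) = (η * √(κ * t / η) * √(1 + √(κ * t / η) ^ 2)) ^ 2 := by
    rw [mul_pow, mul_pow, Real.sq_sqrt hu.le, Real.sq_sqrt (by positivity)]
    field_simp
    ring
  rw [h2, Real.sqrt_sq (by positivity)]
  have h3 := Real.sqrt_pos.2 hu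
  have h4 : 0 < √(1 + √(κ * t / η) ^ 2) := by positivity
  simp only [smul_eq_mul]
  field_simp

lemma arsinh_le_log {s : ℝ} (hs : 0 ≤ s) : Real.arsinh s ≤ Real.log (1 + 2 * s) := by
  unfold Real.arsinh
  have h : √(1 + s ^ 2) ≤ 1 + s := (Real.sqrt_le_left (by positivity)).2 (by nlinarith)
  exact Real.log_le_log (by positivity) (by linarith)

lemma lintegral_inv_sqrt_le {κ η : ℝ} (hκ : 0 < κ) (hη : 0 < η) :
    ∫⁻ t in Ioo (0 : ℝ) Real.pi, ENNReal.ofReal (√(κ * t * (κ * t + η)))⁻¹ ≤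
      ENNReal.ofReal (2 / κ * Real.log (1 + 2 * √(κ * Real.pi / η))) := by
  have hpi := Real.pi_pos
  set G : ℝ → ℝ := fun t => 2 / κ * Real.arsinh √(κ * t / η) with hG
  have hGc : ContinuousOn G (Icc 0 Real.pi) := by
    refine Continuous.continuousOn (continuous_const.mul (Real.continuous_arsinh.comp ?_))
    fun_prop
  have hder : ∀ t ∈ Ioo 0 Real.pi, HasDerivAt G (√(κ * t * (κ * t + η)))⁻¹ t := fun t ht =>
    hasDerivAt_arsinh_sqrt hκ hη ht.1
  have hmean_le := intervalIntegral.integrableOn_deriv_of_nonneg hGc hder fun t _ => by positivity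
  have hftc := intervalIntegral.integral_eq_sub_of_hasDerivAt_of_le hpi.le hGc hder
    ((intervalIntegrable_iff_integrableOn_Ioc_of_le hpi.le).2 hmean_le)
  rw [intervalIntegral.integral_of_le hpi.le] at hftc
  rw [MeasureTheory.restrict_Ioo_eq_restrict_Ioc,
    ← MeasureTheory.ofReal_integral_eq_lintegral_ofReal hmean_le
      (Eventually.of_forall fun t => by positivity), hftc]
  refine ENNReal.ofReal_le_ofReal ?_
  have h1 : G 0 = 0 := by simp [hG]
  rw [h1, sub_zero]
  exact mul_le_mul_of_nonneg_left (arsinh_le_log (by positivity)) (by positivity)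

lemma lintegral_comp_abs_sub_le (ψ : ℝ → ℝ≥0∞) {θ₀ L : ℝ} (h₀ : θ₀ ∈ Icc 0 L) :
    ∫⁻ θ in Ioo (0 : ℝ) L, ψ |θ - θ₀| ≤ 2 * ∫⁻ t in Ioo (0 : ℝ) L, ψ t := by
  have hsub : Ioo (0 : ℝ) L ⊆ ((fun t => θ₀ - t) '' Ioo 0 L ∪ (fun t => θ₀ + t) '' Ioo 0 L) ∪ {θ₀} := by
    intro θ hθ
    rcases lt_trichotomy θ θ₀ with h | h | h
    · exact Or.inl (Or.inl ⟨θ₀ - θ, ⟨by linarith, by linarith [hθ.1, h₀.2]⟩, by ring⟩)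
    · exact Or.inr h
    · exact Or.inl (Or.inr ⟨θ - θ₀, ⟨by linarith, by linarith [hθ.2, h₀.1]⟩, by ring⟩)
  refine (MeasureTheory.lintegral_mono_set hsub).trans ?_
  refine (MeasureTheory.lintegral_union_le _ _ _).trans ?_
  have h0 : ∫⁻ θ in ({θ₀} : Set ℝ), ψ |θ - θ₀| = 0 :=
    MeasureTheory.setLIntegral_measure_zero _ _ (by simp)
  rw [h0, add_zero]
  refine (MeasureTheory.lintegral_union_le _ _ _).trans (le_of_eq ?_)
  rw [MeasureTheory.lintegral_image_eq_lintegral_abs_deriv_mul (f' := fun _ => -1)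
      measurableSet_Ioo (fun x _ => ((hasDerivAt_id' x).const_sub _).hasDerivWithinAt)
      (fun x _ y _ h => by simpa using h),
    MeasureTheory.lintegral_image_eq_lintegral_abs_deriv_mul (f' := fun _ => 1)
      measurableSet_Ioo (fun x _ => ((hasDerivAt_id' x).const_add _).hasDerivWithinAt)
      (fun x _ y _ h => by simpa using h), two_mul]
  congr 1 <;> refine MeasureTheory.setLIntegral_congr_fun measurableSet_Ioo fun t ht => ?_
  · simp [abs_of_pos ht.1]
  · simp [abs_of_pos ht.1]

/-- Quantitative injectivity of the cosine, in terms of one of the two endpoints. -/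
lemma mul_abs_sub_le_abs_segPoint_sub {θ θ₀ : ℝ} (hθ : θ ∈ Icc 0 Real.pi) (h₀ : θ₀ ∈ Icc 0 Real.pi) :
    √(segPoint θ₀ * (1 - segPoint θ₀)) / Real.pi * |θ - θ₀| ≤ |segPoint θ - segPoint θ₀| := by
  have hpi := Real.pi_pos
  have h1 : segPoint θ - segPoint θ₀ = -(Real.sin ((θ + θ₀) / 2) * Real.sin ((θ - θ₀) / 2)) := by
    unfold segPoint
    linear_combination (1 / 2) * Real.cos_sub_cos θ θ₀
  rw [h1, abs_neg, abs_mul, ← abs_sin_div_two, abs_of_nonneg (Real.sin_nonneg_of_mem_Icc h₀)]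
  have h2 : Real.sin θ₀ / 2 ≤ |Real.sin ((θ + θ₀) / 2)| := by
    refine le_trans ?_ (le_abs_self _)
    have hconc := strictConcaveOn_sin_Icc.concaveOn.2 hθ h₀ (by norm_num : (0 : ℝ) ≤ 1 / 2)
      (by norm_num : (0 : ℝ) ≤ 1 / 2) (by norm_num)
    simp only [smul_eq_mul] at hconc
    rw [show 1 / 2 * θ + 1 / 2 * θ₀ = (θ + θ₀) / 2 by ring] at hconc
    linarith [Real.sin_nonneg_of_mem_Icc hθ]
  have h3 : |θ - θ₀| / Real.pi ≤ |Real.sin ((θ - θ₀) / 2)| := by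
    have h4 : |θ - θ₀| ≤ Real.pi := abs_sub_le_of_nonneg_of_le hθ.1 hθ.2 h₀.1 h₀.2
    have h5 := Real.mul_le_sin (x := |θ - θ₀| / 2) (by positivity) (by linarith)
    have h6 : Real.sin (|θ - θ₀| / 2) ≤ |Real.sin ((θ - θ₀) / 2)| := by
      rcases abs_choice (θ - θ₀) with h | h <;> rw [h]
      · exact le_abs_self _
      · rw [neg_div, Real.sin_neg]; exact neg_le_abs _
    calc _ = 2 / Real.pi * (|θ - θ₀| / 2) := by ring
      _ ≤ _ := h5.trans h6
  calc _ = Real.sin θ₀ / 2 * (|θ - θ₀| / Real.pi) := by ring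
    _ ≤ _ := by gcongr

/-- A boundary majorant of `discOp a b c d f`, as a function of the point of `[0, 1]`. -/
def boundaryBound (a b c d : ℝ) (f : ℂ → ℂ) (x : ℝ) : ℝ :=
  open Classical in
  if 0 < (d * x - b) * ((c + d) * x - (a + b)) then
    (2 * d ^ 2 * √((d * x - b) * ((c + d) * x - (a + b))))⁻¹ * circleMean f
  else
    d⁻¹ * (‖f (Complex.exp (Real.arccos (2 * ((d * x - b) / (a - c * x)) - 1) * I))‖ +
      ‖f (Complex.exp (-Real.arccos (2 * ((d * x - b) / (a - c * x)) - 1) * I))‖ + circleMean f)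

lemma segPoint_arccos {x : ℝ} (hx : x ∈ Icc (0 : ℝ) 1) :
    segPoint (Real.arccos (2 * x - 1)) = x := by
  unfold segPoint
  rw [Real.cos_arccos] <;> linarith [hx.1, hx.2]

lemma arccos_segPoint {θ : ℝ} (hθ : θ ∈ Icc 0 Real.pi) :
    Real.arccos (2 * segPoint θ - 1) = θ := by
  unfold segPoint
  rw [show 2 * ((1 + Real.cos θ) / 2) - 1 = Real.cos θ by ring, Real.arccos_cos hθ.1 hθ.2]

namespace MoebiusData

variable {a b c d : ℝ} (hg : MoebiusData a b c d)
include hg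

lemma ratio_inverse {y : ℝ} (hy : y ∈ Icc (0 : ℝ) 1) :
    (d * ((a * y + b) / (c * y + d)) - b) / (a - c * ((a * y + b) / (c * y + d))) = y := by
  have hD := hg.denom_pos hy.1
  have hdet : a * d - b * c ≠ 0 := fun h => by simpa [h] using hg.det
  have h1 : a - c * ((a * y + b) / (c * y + d)) = (a * d - b * c) / (c * y + d) := by
    rw [mul_div_assoc', sub_div' hD.ne']; congr 1; ring
  have h2 : d * ((a * y + b) / (c * y + d)) - b = y * (a * d - b * c) / (c * y + d) := by
    rw [mul_div_assoc', div_sub' hD.ne']; congr 1; ring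
  rw [h1, h2, div_div_div_cancel_right₀ hD.ne', mul_div_cancel_right₀ _ hdet]

lemma inverse_mem {x : ℝ} (hx : (d * x - b) * ((c + d) * x - (a + b)) < 0) :
    (d * x - b) / (a - c * x) ∈ Ioo (0 : ℝ) 1 ∧
      (a * ((d * x - b) / (a - c * x)) + b) / (c * ((d * x - b) / (a - c * x)) + d) = x := by
  have hdet : a * d - b * c ≠ 0 := fun h => by simpa [h] using hg.det
  have h1 : a - c * x = (d * x - b) - ((c + d) * x - (a + b)) := by ring
  have hne : a - c * x ≠ 0 := by
    rw [h1]
    intro h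
    rw [sub_eq_zero.1 h] at hx
    nlinarith [mul_self_nonneg ((c + d) * x - (a + b))]
  refine ⟨?_, ?_⟩
  · rw [h1]
    rcases mul_neg_iff.1 hx with ⟨h2, h3⟩ | ⟨h2, h3⟩
    · exact ⟨div_pos h2 (by linarith), (div_lt_one (by linarith)).2 (by linarith)⟩
    · refine ⟨div_pos_of_neg_of_neg h2 (by linarith), (div_lt_one_of_neg (by linarith)).2 (by linarith)⟩
  · have h2 : c * ((d * x - b) / (a - c * x)) + d = (a * d - b * c) / (a - c * x) := by
      rw [mul_div_assoc', div_add' _ _ _ hne]; congr 1; ring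
    have h3 : a * ((d * x - b) / (a - c * x)) + b = x * (a * d - b * c) / (a - c * x) := by
      rw [mul_div_assoc', div_add' _ _ _ hne]; congr 1; ring
    rw [h2, h3, div_div_div_cancel_right₀ hne, mul_div_cancel_right₀ _ hdet]

lemma ratio_mul_one_sub {y : ℝ} (hy : y ∈ Icc (0 : ℝ) 1) :
    b * (d - b) / (c * y + d) ^ 2 ≤
      (a * y + b) / (c * y + d) * (1 - (a * y + b) / (c * y + d)) := by
  have hD := hg.denom_pos hy.1
  have h1 : (a * y + b) / (c * y + d) * (1 - (a * y + b) / (c * y + d)) =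
      (a * y + b) * ((c - a) * y + (d - b)) / (c * y + d) ^ 2 := by
    rw [one_sub_div hD.ne', div_mul_div_comm, ← sq]; congr 1; ring
  rw [h1]
  have h2 := mul_nonneg hg.a_nonneg hy.1
  have h3 := mul_nonneg (sub_nonneg.2 hg.a_le_c) hy.1
  have h4 := hg.b_pos
  have h5 := sub_pos.2 hg.b_lt_d
  gcongr <;> linarith

lemma boundaryBound_le_off_image {f : ℂ → ℂ} {θ θ₀ θ₁ : ℝ} (hθ : θ ∈ Icc 0 Real.pi)
    (hθ₀ : θ₀ ∈ Icc 0 Real.pi) (hθ₁ : θ₁ ∈ Icc 0 Real.pi) (h₀ : segPoint θ₀ = b / d)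
    (h₁ : segPoint θ₁ = (a + b) / (c + d)) {κ η : ℝ}
    (hκ : κ = √(b * (d - b)) / (2 * Real.pi * d)) (hη : η = (d * (c + d))⁻¹)
    (hpos : 0 < (d * segPoint θ - b) * ((c + d) * segPoint θ - (a + b))) :
    boundaryBound a b c d f (segPoint θ) ≤ (2 * d ^ 3)⁻¹ * circleMean f *
      ((√(κ * |θ - θ₀| * (κ * |θ - θ₀| + η)))⁻¹ + (√(κ * |θ - θ₁| * (κ * |θ - θ₁| + η)))⁻¹) := by
  unfold boundaryBound
  rw [if_pos hpos]
  have hd := hg.d_pos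
  have hc := hg.c_pos
  have hpi := Real.pi_pos
  have hbd : 0 < b * (d - b) := mul_pos hg.b_pos (sub_pos.2 hg.b_lt_d)
  have hs := Real.sqrt_pos.2 hbd
  have hκ0 : 0 < κ := by rw [hκ]; positivity
  have hη0 : 0 < η := by rw [hη]; positivity
  have endpoint : ∀ σ ∈ Icc 0 Real.pi, ∀ y ∈ Icc (0 : ℝ) 1,
      segPoint σ = (a * y + b) / (c * y + d) → κ * |θ - σ| ≤ |segPoint θ - segPoint σ| := by
    intro σ hσ y hy hy'
    refine le_trans ?_ (mul_abs_sub_le_abs_segPoint_sub hθ hσ)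
    refine mul_le_mul_of_nonneg_right ?_ (abs_nonneg _)
    have hD := hg.denom_pos hy.1
    have h2 : √(b * (d - b)) / (c * y + d) ≤ √(segPoint σ * (1 - segPoint σ)) := by
      refine Real.le_sqrt_of_sq_le ?_
      rw [div_pow, Real.sq_sqrt hbd.le, hy']
      exact hg.ratio_mul_one_sub hy
    have h3 : c * y + d ≤ 2 * d := by nlinarith [hg.c_le_d, hy.1, hy.2]
    rw [hκ]
    calc _ = √(b * (d - b)) / (2 * d) / Real.pi := by field_simp
      _ ≤ √(b * (d - b)) / (c * y + d) / Real.pi := by gcongr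
      _ ≤ _ := by gcongr
  have e₀ := endpoint θ₀ hθ₀ 0 (by simp) (by simpa using h₀)
  have e₁ := endpoint θ₁ hθ₁ 1 (by simp) (by simpa [add_comm] using h₁)
  rw [h₀] at e₀
  rw [h₁] at e₁
  set x := segPoint θ with hx
  have hdist : |b / d - (a + b) / (c + d)| = η := by
    have h2 : b / d - (a + b) / (c + d) = -(a * d - b * c) / (d * (c + d)) := by field_simp; ring
    have hdet : |a * d - b * c| = 1 := by
      rw [← sq_eq_sq₀ (abs_nonneg _) zero_le_one, sq_abs, hg.det, one_pow]
    rw [h2, abs_div, abs_neg, hdet, abs_of_pos (by positivity), hη, one_div]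
  have hfactor : (d * x - b) * ((c + d) * x - (a + b)) =
      d * (c + d) * ((x - b / d) * (x - (a + b) / (c + d))) := by field_simp
  have hppos : 0 < (x - b / d) * (x - (a + b) / (c + d)) := by
    rw [hfactor] at hpos
    exact pos_of_mul_pos_right hpos (by positivity)
  have hprod : (d * x - b) * ((c + d) * x - (a + b)) =
      d * (c + d) * (|x - b / d| * |x - (a + b) / (c + d)|) := by
    rw [hfactor, ← abs_mul, abs_of_pos hppos]
  have hcases : |x - (a + b) / (c + d)| = |x - b / d| + η ∨
      |x - b / d| = |x - (a + b) / (c + d)| + η := by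
    rw [← hdist]
    rcases pos_and_pos_or_neg_and_neg_of_mul_pos hppos with ⟨h2, h3⟩ | ⟨h2, h3⟩
    · rw [abs_of_pos h2, abs_of_pos h3]
      rcases le_total (b / d) ((a + b) / (c + d)) with h | h
      · right; rw [abs_of_nonpos (by linarith)]; ring
      · left; rw [abs_of_nonneg (by linarith)]; ring
    · rw [abs_of_neg h2, abs_of_neg h3]
      rcases le_total (b / d) ((a + b) / (c + d)) with h | h
      · left; rw [abs_of_nonpos (by linarith)]; ring
      · right; rw [abs_of_nonneg (by linarith)]; ring
  have nearest : ∀ u t : ℝ, 0 < t → κ * t ≤ u →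
      (d * x - b) * ((c + d) * x - (a + b)) = d * (c + d) * (u * (u + η)) →
      (2 * d ^ 2 * √((d * x - b) * ((c + d) * x - (a + b))))⁻¹ ≤
        (2 * d ^ 3)⁻¹ * (√(κ * t * (κ * t + η)))⁻¹ := by
    intro u t ht htu hu
    have hκt : 0 < κ * t := by positivity
    have hu0 : 0 ≤ u := hκt.le.trans htu
    have h2 : d * √(κ * t * (κ * t + η)) ≤ √((d * x - b) * ((c + d) * x - (a + b))) := by
      refine Real.le_sqrt_of_sq_le ?_
      rw [mul_pow, Real.sq_sqrt (by positivity), hu, sq]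
      gcongr
      linarith
    have h3 : 0 < √(κ * t * (κ * t + η)) := Real.sqrt_pos.2 (by positivity)
    rw [← mul_inv]
    refine inv_anti₀ (by positivity) ?_
    calc _ = 2 * d ^ 2 * (d * √(κ * t * (κ * t + η))) := by ring
      _ ≤ _ := by gcongr
  have hne₀ : 0 < |θ - θ₀| := by
    rw [abs_pos, sub_ne_zero]
    rintro rfl
    rw [← hx] at h₀
    simp [h₀] at hppos
  have hne₁ : 0 < |θ - θ₁| := by
    rw [abs_pos, sub_ne_zero]
    rintro rfl
    rw [← hx] at h₁
    simp [h₁] at hppos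
  have hm : 0 ≤ circleMean f := circleMean_nonneg
  have key : (2 * d ^ 2 * √((d * x - b) * ((c + d) * x - (a + b))))⁻¹ ≤ (2 * d ^ 3)⁻¹ *
      ((√(κ * |θ - θ₀| * (κ * |θ - θ₀| + η)))⁻¹ + (√(κ * |θ - θ₁| * (κ * |θ - θ₁| + η)))⁻¹) := by
    rw [mul_add]
    rcases hcases with h | h
    · refine (nearest _ _ hne₀ e₀ (by rw [hprod, h])).trans (le_add_of_nonneg_right (by positivity))
    · refine (nearest _ _ hne₁ e₁ (by rw [hprod, h]; ring)).trans
        (le_add_of_nonneg_left (by positivity))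
  calc _ ≤ _ := mul_le_mul_of_nonneg_right key hm
    _ = _ := by ring

end MoebiusData

lemma integral_norm_exp_add {f : ℂ → ℂ} (hf : ContinuousOn f (Metric.closedBall 0 1)) :
    ∫ τ in (0 : ℝ)..Real.pi, (‖f (Complex.exp (τ * I))‖ + ‖f (Complex.exp (-τ * I))‖ +
      circleMean f) = 3 * Real.pi * circleMean f := by
  have hc := (continuous_comp_exp hf).norm
  have hc' : Continuous fun τ : ℝ => ‖f (Complex.exp (-τ * I))‖ := by
    simpa [Function.comp_def] using hc.comp continuous_neg
  have h1 : ∫ τ in (0 : ℝ)..Real.pi, ‖f (Complex.exp (-τ * I))‖ =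
      ∫ τ in Real.pi..(2 * Real.pi), ‖f (Complex.exp (τ * I))‖ := by
    have h := intervalIntegral.integral_comp_sub_left (a := 0) (b := Real.pi)
      (fun τ : ℝ => ‖f (Complex.exp (τ * I))‖) (2 * Real.pi)
    rw [sub_zero, show 2 * Real.pi - Real.pi = Real.pi by ring] at h
    rw [← h]
    congr 1
    funext τ
    have : Complex.exp (((2 * Real.pi - τ : ℝ) : ℂ) * I) = Complex.exp (-τ * I) := by
      rw [← Complex.exp_periodic (-τ * I)]; congr 1; push_cast; ring
    rw [this]
  rw [intervalIntegral.integral_add ((hc.fun_add hc').intervalIntegrable _ _) (by simp),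
    intervalIntegral.integral_add (hc.intervalIntegrable _ _) (hc'.intervalIntegrable _ _), h1,
    intervalIntegral.integral_add_adjacent_intervals (hc.intervalIntegrable _ _)
      (hc.intervalIntegrable _ _), intervalIntegral.integral_const, smul_eq_mul]
  have h2 : ∫ τ in (0 : ℝ)..(2 * Real.pi), ‖f (Complex.exp (τ * I))‖ =
      2 * Real.pi * circleMean f := by
    unfold circleMean
    rw [mul_inv_cancel_left₀ (by positivity)]
  rw [h2]
  ring

lemma ae_segPoint_notMem {s : Set ℝ} (hs : s.Finite) :
    ∀ᵐ θ : ℝ ∂MeasureTheory.volume.restrict (Ioc (0 : ℝ) (2 * Real.pi)), segPoint θ ∉ s := by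
  rw [MeasureTheory.ae_restrict_iff' measurableSet_Ioc]
  have hfin := (hs.image fun x => Real.arccos (2 * x - 1)).union
    (hs.image fun x => 2 * Real.pi - Real.arccos (2 * x - 1))
  filter_upwards [MeasureTheory.measure_eq_zero_iff_ae_notMem.1 (hfin.measure_zero _)] with θ h hθ hmem
  refine h ?_
  rcases le_total θ Real.pi with h1 | h1
  · exact Or.inl ⟨segPoint θ, hmem, arccos_segPoint ⟨hθ.1.le, h1⟩⟩
  · refine Or.inr ⟨segPoint θ, hmem, ?_⟩
    have h2 : segPoint (2 * Real.pi - θ) = segPoint θ := by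
      unfold segPoint; rw [Real.cos_two_pi_sub]
    dsimp only
    rw [← h2, arccos_segPoint ⟨by linarith [hθ.2], by linarith⟩]
    ring

namespace MoebiusData

variable {a b c d : ℝ} (hg : MoebiusData a b c d)
include hg

lemma lintegral_boundaryBound_off_image_le (f : ℂ → ℂ) :
    ∫⁻ θ in Ioo 0 Real.pi ∩
        {θ | 0 < (d * segPoint θ - b) * ((c + d) * segPoint θ - (a + b))},
      ENNReal.ofReal (boundaryBound a b c d f (segPoint θ)) ≤
      ENNReal.ofReal (16 * Real.pi * Real.log (1 + d) / (d ^ 2 * √(b * (d - b))) *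
        circleMean f) := by
  have hd := hg.d_pos
  have hc := hg.c_pos
  have hb := hg.b_pos
  have hpi := Real.pi_pos
  have hm : 0 ≤ circleMean f := circleMean_nonneg
  have hbd : 0 < b * (d - b) := mul_pos hg.b_pos (sub_pos.2 hg.b_lt_d)
  have hs := Real.sqrt_pos.2 hbd
  set κ := √(b * (d - b)) / (2 * Real.pi * d) with hκ
  set η := (d * (c + d))⁻¹ with hη
  have hκ0 : 0 < κ := by positivity
  have hη0 : 0 < η := by positivity
  have hx₀ : b / d ∈ Icc (0 : ℝ) 1 := by simpa using hg.ratio_mem (y := 0) (by simp)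
  have hx₁ : (a + b) / (c + d) ∈ Icc (0 : ℝ) 1 := by simpa using hg.ratio_mem (y := 1) (by simp)
  set θ₀ := Real.arccos (2 * (b / d) - 1)
  set θ₁ := Real.arccos (2 * ((a + b) / (c + d)) - 1)
  have hθ₀ : θ₀ ∈ Icc 0 Real.pi := ⟨Real.arccos_nonneg _, Real.arccos_le_pi _⟩
  have hθ₁ : θ₁ ∈ Icc 0 Real.pi := ⟨Real.arccos_nonneg _, Real.arccos_le_pi _⟩
  set ψ : ℝ → ℝ≥0∞ := fun t => ENNReal.ofReal (√(κ * t * (κ * t + η)))⁻¹ with hψ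
  have hlog : ∫⁻ t in Ioo 0 Real.pi, ψ t ≤
      ENNReal.ofReal (8 * Real.pi * d / √(b * (d - b)) * Real.log (1 + d)) := by
    refine (lintegral_inv_sqrt_le hκ0 hη0).trans (ENNReal.ofReal_le_ofReal ?_)
    have h1 : √(κ * Real.pi / η) ≤ d := by
      rw [Real.sqrt_le_left hd.le]
      have h2 : √(b * (d - b)) ≤ d := by
        rw [Real.sqrt_le_left hd.le]; nlinarith [hg.b_lt_d, sq_nonneg (d - b)]
      calc κ * Real.pi / η = √(b * (d - b)) * ((c + d) / 2) := by rw [hκ, hη]; field_simp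
        _ ≤ d * d := by gcongr; linarith [hg.c_le_d]
        _ = _ := by ring
    have h3 : Real.log (1 + 2 * √(κ * Real.pi / η)) ≤ 2 * Real.log (1 + d) := by
      rw [← Real.log_rpow (by positivity), Real.rpow_two]
      refine Real.log_le_log (by positivity) ?_
      nlinarith
    calc _ ≤ 2 / κ * (2 * Real.log (1 + d)) := by gcongr
      _ = _ := by rw [hκ]; field_simp; ring
  have hψm : Measurable ψ := by rw [hψ]; fun_prop
  have hmeas : MeasurableSet (Ioo 0 Real.pi ∩
      {θ | 0 < (d * segPoint θ - b) * ((c + d) * segPoint θ - (a + b))}) := by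
    refine measurableSet_Ioo.inter (measurableSet_lt measurable_const ?_)
    have := continuous_segPoint
    fun_prop
  calc _ ≤ ∫⁻ θ in Ioo 0 Real.pi ∩
        {θ | 0 < (d * segPoint θ - b) * ((c + d) * segPoint θ - (a + b))},
        ENNReal.ofReal ((2 * d ^ 3)⁻¹ * circleMean f) * (ψ |θ - θ₀| + ψ |θ - θ₁|) := by
        refine MeasureTheory.setLIntegral_mono' hmeas fun θ hθ => ?_
        rw [hψ, ← ENNReal.ofReal_add (by positivity) (by positivity),
          ← ENNReal.ofReal_mul (by positivity)]
        exact ENNReal.ofReal_le_ofReal (hg.boundaryBound_le_off_image (Ioo_subset_Icc_self hθ.1)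
          hθ₀ hθ₁ (segPoint_arccos hx₀) (segPoint_arccos hx₁) hκ hη hθ.2)
    _ ≤ ∫⁻ θ in Ioo 0 Real.pi,
        ENNReal.ofReal ((2 * d ^ 3)⁻¹ * circleMean f) * (ψ |θ - θ₀| + ψ |θ - θ₁|) :=
        MeasureTheory.lintegral_mono_set inter_subset_left
    _ = ENNReal.ofReal ((2 * d ^ 3)⁻¹ * circleMean f) *
        ((∫⁻ θ in Ioo 0 Real.pi, ψ |θ - θ₀|) + ∫⁻ θ in Ioo 0 Real.pi, ψ |θ - θ₁|) := by
        rw [MeasureTheory.lintegral_const_mul' _ _ ENNReal.ofReal_ne_top,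
          MeasureTheory.lintegral_add_left (f := fun θ => ψ |θ - θ₀|) (by fun_prop)]
    _ ≤ ENNReal.ofReal ((2 * d ^ 3)⁻¹ * circleMean f) *
        (2 * ENNReal.ofReal (8 * Real.pi * d / √(b * (d - b)) * Real.log (1 + d)) +
          2 * ENNReal.ofReal (8 * Real.pi * d / √(b * (d - b)) * Real.log (1 + d))) := by
        gcongr
        · exact (lintegral_comp_abs_sub_le ψ hθ₀).trans (by gcongr)
        · exact (lintegral_comp_abs_sub_le ψ hθ₁).trans (by gcongr)
    _ = _ := by
        have hl : 0 ≤ Real.log (1 + d) := Real.log_nonneg (by linarith)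
        have h2 : (2 : ℝ≥0∞) = ENNReal.ofReal 2 := by simp
        rw [h2, ← ENNReal.ofReal_mul (by positivity), ← ENNReal.ofReal_add (by positivity)
          (by positivity), ← ENNReal.ofReal_mul (by positivity)]
        congr 1
        field_simp
        ring

lemma lintegral_boundaryBound_image_le {f : ℂ → ℂ} (hf : ContinuousOn f (Metric.closedBall 0 1)) :
    ∫⁻ θ in Ioo 0 Real.pi ∩
        {θ | (d * segPoint θ - b) * ((c + d) * segPoint θ - (a + b)) < 0},
      ENNReal.ofReal (boundaryBound a b c d f (segPoint θ)) ≤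
      ENNReal.ofReal (3 * Real.pi / (2 * d ^ 2 * √(b * (d - b))) * circleMean f) := by
  have hd := hg.d_pos
  have hpi := Real.pi_pos
  have hm : 0 ≤ circleMean f := circleMean_nonneg
  have hbd : 0 < b * (d - b) := mul_pos hg.b_pos (sub_pos.2 hg.b_lt_d)
  have hs := Real.sqrt_pos.2 hbd
  set T : ℝ → ℝ := fun τ =>
    Real.arccos (2 * ((a * segPoint τ + b) / (c * segPoint τ + d)) - 1) with hT
  set Ψ : ℝ → ℝ≥0∞ := fun θ =>
    ENNReal.ofReal (d⁻¹ * (‖f (Complex.exp (Real.arccos (2 * ((d * segPoint θ - b) /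
        (a - c * segPoint θ)) - 1) * I))‖ +
      ‖f (Complex.exp (-Real.arccos (2 * ((d * segPoint θ - b) / (a - c * segPoint θ)) - 1) * I))‖ +
      circleMean f)) with hΨ
  have hTseg : ∀ τ, segPoint (T τ) = (a * segPoint τ + b) / (c * segPoint τ + d) := fun τ =>
    segPoint_arccos (hg.ratio_mem (segPoint_mem_Icc τ))
  have hinv : ∀ τ ∈ Ioo 0 Real.pi,
      Real.arccos (2 * ((d * segPoint (T τ) - b) / (a - c * segPoint (T τ))) - 1) = τ := by
    intro τ hτ
    rw [hTseg, hg.ratio_inverse (segPoint_mem_Icc τ), arccos_segPoint (Ioo_subset_Icc_self hτ)]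
  have hinj : InjOn T (Ioo 0 Real.pi) := by
    intro τ hτ σ hσ h
    rw [← hinv τ hτ, ← hinv σ hσ, h]
  have hsub : Ioo 0 Real.pi ∩ {θ | (d * segPoint θ - b) * ((c + d) * segPoint θ - (a + b)) < 0} ⊆
      T '' Ioo 0 Real.pi := by
    rintro θ ⟨hθ, hneg⟩
    obtain ⟨hy, hgy⟩ := hg.inverse_mem hneg
    refine ⟨Real.arccos (2 * ((d * segPoint θ - b) / (a - c * segPoint θ)) - 1), ⟨?_, ?_⟩, ?_⟩
    · rw [Real.arccos_pos]; linarith [hy.2]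
    · refine lt_of_le_of_ne (Real.arccos_le_pi _) fun h => ?_
      rw [Real.arccos_eq_pi] at h
      linarith [hy.1]
    · rw [hT]
      dsimp only
      rw [segPoint_arccos (Ioo_subset_Icc_self hy), hgy, arccos_segPoint (Ioo_subset_Icc_self hθ)]
  have hder : ∀ τ ∈ Ioo 0 Real.pi, ∃ D : ℝ, HasDerivAt T D τ ∧
      |D| ≤ (2 * d * √(b * (d - b)))⁻¹ := by
    intro τ hτ
    have hy := segPoint_mem_Icc τ
    have hD := hg.denom_pos hy.1
    have hsin := Real.sin_pos_of_mem_Ioo hτ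
    have hseg : HasDerivAt segPoint (-Real.sin τ / 2) τ := by
      unfold segPoint
      exact ((Real.hasDerivAt_cos τ).const_add 1).div_const 2
    have hx := hg.ratio_mul_one_sub hy
    set y := segPoint τ with hydef
    have hgder : HasDerivAt (fun τ => 2 * ((a * segPoint τ + b) / (c * segPoint τ + d)) - 1)
        (2 * ((a * d - b * c) * (-Real.sin τ / 2) / (c * y + d) ^ 2)) τ := by
      refine ((((((hseg.const_mul a).add_const b).div ((hseg.const_mul c).add_const d)
        hD.ne').const_mul 2).sub_const 1)).congr_deriv ?_
      congr 2
      rw [← hydef]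
      ring
    set x := (a * y + b) / (c * y + d) with hxdef
    have hxpos : 0 < x * (1 - x) := lt_of_lt_of_le (by positivity) hx
    have h1 : 1 - (2 * x - 1) ^ 2 = 4 * (x * (1 - x)) := by ring
    have hne1 : 2 * x - 1 ≠ -1 := fun h => by
      have : x = 0 := by linarith
      simp [this] at hxpos
    have hne2 : 2 * x - 1 ≠ 1 := fun h => by
      have : x = 1 := by linarith
      simp [this] at hxpos
    refine ⟨_, HasDerivAt.comp (h₂ := Real.arccos) τ (Real.hasDerivAt_arccos hne1 hne2) hgder, ?_⟩
    have hdet : |a * d - b * c| = 1 := by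
      rw [← sq_eq_sq₀ (abs_nonneg _) zero_le_one, sq_abs, hg.det, one_pow]
    have h2 : √(1 - (2 * x - 1) ^ 2) = 2 * √(x * (1 - x)) := by
      rw [h1, Real.sqrt_mul (by norm_num), show (4 : ℝ) = 2 ^ 2 by norm_num,
        Real.sqrt_sq (by norm_num)]
    have h3 : √(b * (d - b)) / (c * y + d) ≤ √(x * (1 - x)) := by
      refine Real.le_sqrt_of_sq_le ?_
      rw [div_pow, Real.sq_sqrt hbd.le]
      exact hx
    have h6 : |2 * ((a * d - b * c) * (-Real.sin τ / 2) / (c * y + d) ^ 2)| =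
        Real.sin τ / (c * y + d) ^ 2 := by
      rw [show 2 * ((a * d - b * c) * (-Real.sin τ / 2) / (c * y + d) ^ 2) =
        -((a * d - b * c) * Real.sin τ / (c * y + d) ^ 2) by ring, abs_neg, abs_div, abs_mul, hdet,
        abs_of_pos hsin, abs_of_pos (pow_pos hD 2), one_mul]
    have h7 := Real.sqrt_pos.2 hxpos
    rw [h2, abs_mul, abs_neg, h6, abs_of_pos (by positivity)]
    have h4 := Real.sin_le_one τ
    have h5 := hg.d_le_denom hy.1
    calc _ = Real.sin τ / (2 * √(x * (1 - x)) * (c * y + d) ^ 2) := by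
          rw [div_mul_div_comm, one_mul]
      _ ≤ 1 / (2 * (√(b * (d - b)) / (c * y + d)) * (c * y + d) ^ 2) := by gcongr
      _ = 1 / (2 * √(b * (d - b)) * (c * y + d)) := by
          generalize c * y + d = u at hD
          field_simp
      _ ≤ 1 / (2 * √(b * (d - b)) * d) := by gcongr
      _ = _ := by rw [one_div]; congr 1; ring
  choose! D hD hDle using hder
  have hcont : Continuous fun τ : ℝ => d⁻¹ * (‖f (Complex.exp (τ * I))‖ +
      ‖f (Complex.exp (-τ * I))‖ + circleMean f) := by
    have hc := (continuous_comp_exp hf).norm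
    have hc' : Continuous fun τ : ℝ => ‖f (Complex.exp (-τ * I))‖ := by
      simpa [Function.comp_def] using hc.comp continuous_neg
    fun_prop
  have hmeas : MeasurableSet (Ioo 0 Real.pi ∩
      {θ | (d * segPoint θ - b) * ((c + d) * segPoint θ - (a + b)) < 0}) := by
    refine measurableSet_Ioo.inter (measurableSet_lt ?_ measurable_const)
    have := continuous_segPoint
    fun_prop
  calc _ = ∫⁻ θ in Ioo 0 Real.pi ∩
        {θ | (d * segPoint θ - b) * ((c + d) * segPoint θ - (a + b)) < 0}, Ψ θ := by
        refine MeasureTheory.setLIntegral_congr_fun hmeas fun θ hθ => ?_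
        rw [hΨ, boundaryBound, if_neg (not_lt.2 (le_of_lt hθ.2))]
    _ ≤ ∫⁻ θ in T '' Ioo 0 Real.pi, Ψ θ := MeasureTheory.lintegral_mono_set hsub
    _ = ∫⁻ τ in Ioo 0 Real.pi, ENNReal.ofReal |D τ| * Ψ (T τ) :=
        MeasureTheory.lintegral_image_eq_lintegral_abs_deriv_mul measurableSet_Ioo
          (fun τ hτ => (hD τ hτ).hasDerivWithinAt) hinj Ψ
    _ ≤ ∫⁻ τ in Ioo 0 Real.pi, ENNReal.ofReal (2 * d * √(b * (d - b)))⁻¹ *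
          ENNReal.ofReal (d⁻¹ * (‖f (Complex.exp (τ * I))‖ + ‖f (Complex.exp (-τ * I))‖ +
            circleMean f)) := by
        refine MeasureTheory.setLIntegral_mono' measurableSet_Ioo fun τ hτ => ?_
        rw [hΨ]
        dsimp only
        rw [hinv τ hτ]
        exact mul_le_mul_left (ENNReal.ofReal_le_ofReal (hDle τ hτ)) _
    _ = ENNReal.ofReal (2 * d * √(b * (d - b)))⁻¹ * ENNReal.ofReal (∫ τ in (0 : ℝ)..Real.pi,
          d⁻¹ * (‖f (Complex.exp (τ * I))‖ + ‖f (Complex.exp (-τ * I))‖ + circleMean f)) := by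
        rw [MeasureTheory.lintegral_const_mul' _ _ ENNReal.ofReal_ne_top,
          intervalIntegral.integral_of_le hpi.le, MeasureTheory.restrict_Ioo_eq_restrict_Ioc,
          MeasureTheory.ofReal_integral_eq_lintegral_ofReal (hcont.intervalIntegrable _ _).1
            (Eventually.of_forall fun τ => by positivity)]
    _ = _ := by
        rw [intervalIntegral.integral_const_mul, integral_norm_exp_add hf,
          ← ENNReal.ofReal_mul (by positivity)]
        congr 1
        field_simp

lemma lintegral_boundaryBound_le {f : ℂ → ℂ} (hf : ContinuousOn f (Metric.closedBall 0 1)) :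
    ∫⁻ θ in Ioc (0 : ℝ) (2 * Real.pi), ENNReal.ofReal (boundaryBound a b c d f (segPoint θ)) ≤
      ENNReal.ofReal (2 * Real.pi * ((16 * Real.log (1 + d) + 3 / 2) / (d ^ 2 * √(b * (d - b)))) *
        circleMean f) := by
  have hd := hg.d_pos
  have hpi := Real.pi_pos
  have hm : 0 ≤ circleMean f := circleMean_nonneg
  have hl : 0 ≤ Real.log (1 + d) := Real.log_nonneg (by linarith)
  set α : ℝ → ℝ := fun θ => (d * segPoint θ - b) * ((c + d) * segPoint θ - (a + b)) with hα
  have hcover : Ioo 0 Real.pi ⊆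
      (Ioo 0 Real.pi ∩ {θ | 0 < α θ} ∪ Ioo 0 Real.pi ∩ {θ | α θ < 0}) ∪
        {Real.arccos (2 * (b / d) - 1), Real.arccos (2 * ((a + b) / (c + d)) - 1)} := by
    intro θ hθ
    rcases lt_trichotomy (α θ) 0 with h | h | h
    · exact Or.inl (Or.inr ⟨hθ, h⟩)
    · right
      have hcd : 0 < c + d := add_pos hg.c_pos hd
      rcases mul_eq_zero.1 h with h | h
      · left
        rw [← arccos_segPoint (Ioo_subset_Icc_self hθ)]
        congr 3
        rw [eq_div_iff hd.ne']; linarith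
      · right
        rw [mem_singleton_iff, ← arccos_segPoint (Ioo_subset_Icc_self hθ)]
        congr 3
        rw [eq_div_iff hcd.ne']; linarith
    · exact Or.inl (Or.inl ⟨hθ, h⟩)
  rw [lintegral_comp_segPoint fun x => ENNReal.ofReal (boundaryBound a b c d f x)]
  calc _ ≤ 2 * (ENNReal.ofReal (16 * Real.pi * Real.log (1 + d) / (d ^ 2 * √(b * (d - b))) *
        circleMean f) +
        ENNReal.ofReal (3 * Real.pi / (2 * d ^ 2 * √(b * (d - b))) * circleMean f) + 0) := by
        gcongr
        refine (MeasureTheory.lintegral_mono_set hcover).trans ?_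
        refine (MeasureTheory.lintegral_union_le _ _ _).trans (add_le_add ?_ ?_)
        · refine (MeasureTheory.lintegral_union_le _ _ _).trans (add_le_add ?_ ?_)
          · exact hg.lintegral_boundaryBound_off_image_le f
          · exact hg.lintegral_boundaryBound_image_le hf
        · exact (MeasureTheory.setLIntegral_measure_zero _ _
            ((Set.toFinite _).measure_zero _)).le
    _ = _ := by
        have h2 : (2 : ℝ≥0∞) = ENNReal.ofReal 2 := by simp
        rw [h2, add_zero, ← ENNReal.ofReal_add (by positivity) (by positivity),
          ← ENNReal.ofReal_mul (by positivity)]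
        congr 1
        have := Real.sqrt_pos.2 (mul_pos hg.b_pos (sub_pos.2 hg.b_lt_d))
        field_simp

/-- The `L¹` means of `discOp a b c d f` on circles inside the disc. -/
lemma lintegral_discOp_le {f : ℂ → ℂ} {ρ : ℝ} (hρ : 1 < ρ)
    (hf : DifferentiableOn ℂ f (Metric.ball 0 ρ)) (hf0 : f 0 = 0) {r : ℝ} (hr : 0 < r)
    (hr1 : r < 1) :
    ∫⁻ θ in Ioc (0 : ℝ) (2 * Real.pi), ‖discOp a b c d f (r * Complex.exp (θ * I))‖ₑ ≤
      ENNReal.ofReal (2 * Real.pi * ((16 * Real.log (1 + d) + 3 / 2) / (d ^ 2 * √(b * (d - b)))) *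
        circleMean f) := by
  have hfc : ContinuousOn f (Metric.closedBall 0 1) :=
    hf.continuousOn.mono (Metric.closedBall_subset_ball hρ)
  obtain ⟨C, hC⟩ := hg.exists_norm_discOp_le hρ hf hf0
  refine (lintegral_circle_le_of_eventually (hg.differentiableOn_discOp hfc) hC
    (B := fun θ => boundaryBound a b c d f (segPoint θ)) ?_ hr hr1).trans
    (hg.lintegral_boundaryBound_le hfc)
  have hnull : ∀ᵐ θ : ℝ ∂MeasureTheory.volume.restrict (Ioc (0 : ℝ) (2 * Real.pi)),
      (d * segPoint θ - b) * ((c + d) * segPoint θ - (a + b)) ≠ 0 := by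
    have hcd : 0 < c + d := add_pos hg.c_pos hg.d_pos
    filter_upwards [ae_segPoint_notMem (Set.toFinite {b / d, (a + b) / (c + d)})] with θ hθ h
    refine hθ ?_
    rcases mul_eq_zero.1 h with h | h
    · left; rw [eq_div_iff hg.d_pos.ne']; linarith
    · right; rw [mem_singleton_iff, eq_div_iff hcd.ne']; linarith
  filter_upwards [hnull] with θ hθ ε hε
  unfold boundaryBound
  split_ifs with h
  · exact hg.eventually_norm_discOp_le_off_image hfc h hε
  · obtain ⟨hy, hgy⟩ := hg.inverse_mem (lt_of_le_of_ne (not_lt.1 h) hθ)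
    refine hg.eventually_norm_discOp_le_image hρ hf hf0 ?_ hε
    rw [segPoint_arccos (Ioo_subset_Icc_self hy), hgy]

end MoebiusData

lemma isOpen_cutPlane : IsOpen (cutPlane 0 1) :=
  (isCompact_Icc.image Complex.continuous_ofReal).isClosed.isOpen_compl

/-- The derivative of a Cauchy integral off the segment. -/
lemma hasDerivAt_cutIntegral_cauchyKernel {f : ℂ → ℂ}
    (hf : ContinuousOn f (Metric.closedBall 0 1)) {p : ℂ} (hp : p ∈ cutPlane 0 1) :
    HasDerivAt (fun z => cutIntegral f fun y => ((y : ℂ) - z)⁻¹)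
      (cutIntegral f fun y => (((y : ℂ) - p) ^ 2)⁻¹) p := by
  unfold cutIntegral
  refine HasDerivAt.const_mul _ ?_
  have hne : ∀ q ∈ cutPlane 0 1 ×ˢ (univ : Set ℝ), ((segPoint q.2 : ℝ) : ℂ) - q.1 ≠ 0 :=
    fun q hq h => hq.1 ⟨_, segPoint_mem_Icc q.2, sub_eq_zero.1 h⟩
  have hsc := continuous_segPoint
  refine hasDerivAt_integral_mul isOpen_cutPlane
    (((continuous_comp_exp hf).mul (by fun_prop)).intervalIntegrable _ _)
    (k := fun z θ => ((segPoint θ : ℂ) - z)⁻¹) (k' := fun z θ => (((segPoint θ : ℂ) - z) ^ 2)⁻¹)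
    ?_ ?_ ?_ hp
  · exact ContinuousOn.inv₀ (by fun_prop) hne
  · exact ContinuousOn.inv₀ (by fun_prop) fun q hq => pow_ne_zero 2 (hne q hq)
  · intro z hz θ
    simpa using ((hasDerivAt_id' z).const_sub (segPoint θ : ℂ)).fun_inv (hne (z, θ) ⟨hz, mem_univ _⟩)

lemma Fdisc_of_ne {φ : ℂ → ℂ} {w : ℂ} (hw : w ≠ 0) : Fdisc φ w = φ (joukowski w) := if_neg hw

lemma Fdisc_zero (φ : ℂ → ℂ) : Fdisc φ 0 = 0 := if_pos rfl

lemma hasDerivAt_joukowski {w : ℂ} (hw : w ≠ 0) :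
    HasDerivAt joukowski ((w ^ 2 - 1) / (4 * w ^ 2)) w := by
  have h := (((hasDerivAt_id' w).add_const 1).fun_pow 2).fun_div ((hasDerivAt_id' w).const_mul 4)
    (mul_ne_zero (by norm_num) hw)
  refine h.congr_deriv ?_
  push_cast
  field_simp
  ring

lemma tendsto_joukowski_zero : Tendsto joukowski (𝓝[≠] 0) (Bornology.cobounded ℂ) := by
  rw [← tendsto_norm_atTop_iff_cobounded]
  have h1 : Tendsto (fun w : ℂ => ‖(w + 1) ^ 2 / 4‖) (𝓝[≠] 0) (𝓝 (4⁻¹ : ℝ)) := by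
    have : Continuous fun w : ℂ => ‖(w + 1) ^ 2 / 4‖ := by fun_prop
    simpa using (this.tendsto 0).mono_left (nhdsWithin_le_nhds (s := {0}ᶜ))
  have h2 : Tendsto (fun w : ℂ => ‖w⁻¹‖) (𝓝[≠] 0) atTop := tendsto_norm_inv_nhdsNE_zero_atTop
  refine (h1.pos_mul_atTop (by norm_num) h2).congr fun w => ?_
  rw [← norm_mul, joukowski, ← div_eq_mul_inv, div_div]

/-- Functions of `O1 0 1` correspond to holomorphic functions on the disc. -/
lemma differentiableOn_Fdisc {φ : ℂ → ℂ} (hφ : φ ∈ O1 0 1) :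
    DifferentiableOn ℂ (Fdisc φ) (Metric.ball 0 1) := by
  rw [← Complex.differentiableOn_compl_singleton_and_continuousAt_iff
    (Metric.ball_mem_nhds (0 : ℂ) one_pos)]
  constructor
  · intro w hw
    have hw0 : w ≠ 0 := hw.2
    have h1 := hφ.1.differentiableAt
      (isOpen_cutPlane.mem_nhds (joukowski_mem_cutPlane hw0 (mem_ball_zero_iff.1 hw.1)))
    refine ((h1.comp w (hasDerivAt_joukowski hw0).differentiableAt).congr_of_eventuallyEq
      ?_).differentiableWithinAt
    filter_upwards [isOpen_ne.mem_nhds hw0] with v hv using Fdisc_of_ne hv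
  · rw [continuousAt_iff_punctured_nhds, Fdisc_zero]
    refine (hφ.2.comp tendsto_joukowski_zero).congr' ?_
    filter_upwards [self_mem_nhdsWithin] with v hv using (Fdisc_of_ne hv).symm

lemma mul_mem_ball_of_mem_ball {R : ℝ} (hR : R ∈ Ioo (0 : ℝ) 1) {w : ℂ}
    (hw : w ∈ Metric.ball (0 : ℂ) R⁻¹) : (R : ℂ) * w ∈ Metric.ball (0 : ℂ) 1 := by
  rw [mem_ball_zero_iff] at *
  rw [norm_mul, Complex.norm_real, Real.norm_of_nonneg hR.1.le]
  calc R * ‖w‖ < R * R⁻¹ := mul_lt_mul_of_pos_left hw hR.1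
    _ = 1 := mul_inv_cancel₀ hR.1.ne'

lemma differentiableOn_Fdisc_mul {φ : ℂ → ℂ} (hφ : φ ∈ O1 0 1) {R : ℝ} (hR : R ∈ Ioo (0 : ℝ) 1) :
    DifferentiableOn ℂ (fun w => Fdisc φ (R * w)) (Metric.ball 0 R⁻¹) :=
  (differentiableOn_Fdisc hφ).comp (by fun_prop) fun _ hw => mul_mem_ball_of_mem_ball hR hw

lemma ofReal_circleMean_le_Hnorm (φ : ℂ → ℂ) {R : ℝ} (hR : R ∈ Ioo (0 : ℝ) 1) :
    ENNReal.ofReal (circleMean fun w => Fdisc φ (R * w)) ≤ Hnorm φ :=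
  le_iSup (fun r : Ioo (0 : ℝ) 1 => ENNReal.ofReal ((2 * Real.pi)⁻¹ *
    ∫ θ in (0 : ℝ)..(2 * Real.pi), ‖Fdisc φ ((r : ℝ) * Complex.exp (θ * I))‖)) ⟨R, hR⟩

/-- The derivative of `φ` off the segment, recovered from the boundary values of its dilations. -/
lemma tendsto_cutIntegral_dilation_sq {φ : ℂ → ℂ} (hφ : φ ∈ O1 0 1) {p : ℂ}
    (hp : p ∈ cutPlane 0 1) :
    Tendsto (fun R : ℝ => cutIntegral (fun w => Fdisc φ (R * w)) fun y => (((y : ℂ) - p) ^ 2)⁻¹)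
      (𝓝[Ioo 0 1] 1) (𝓝 (deriv φ p)) := by
  obtain ⟨w, hw, hw1, rfl⟩ := exists_joukowski_eq hp
  have hF := differentiableOn_Fdisc hφ
  have hwB : w ∈ Metric.ball (0 : ℂ) 1 := mem_ball_zero_iff.2 hw1
  have hJ := hasDerivAt_joukowski hw
  set J' := (w ^ 2 - 1) / (4 * w ^ 2) with hJ'
  have hJ0 : J' ≠ 0 := by
    refine div_ne_zero (fun h => ?_) (mul_ne_zero (by norm_num) (pow_ne_zero 2 hw))
    have : ‖w ^ 2‖ = 1 := by rw [sub_eq_zero.1 h, norm_one]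
    rw [norm_pow] at this
    nlinarith [norm_nonneg w]
  have hderiv : deriv φ (joukowski w) * J' = deriv (Fdisc φ) w := by
    have h1 := (hφ.1.differentiableAt (isOpen_cutPlane.mem_nhds hp)).hasDerivAt.comp w hJ
    refine (h1.congr_of_eventuallyEq ?_).deriv.symm
    filter_upwards [isOpen_ne.mem_nhds hw] with v hv using Fdisc_of_ne hv
  have hR : ∀ R ∈ Ioo (0 : ℝ) 1,
      cutIntegral (fun w => Fdisc φ (R * w)) (fun y => (((y : ℂ) - joukowski w) ^ 2)⁻¹) =
        deriv (Fdisc φ) (R * w) * R / J' := by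
    intro R hR
    have hρ : 1 < R⁻¹ := (one_lt_inv₀ hR.1).2 hR.2
    have hd := differentiableOn_Fdisc_mul hφ hR
    have h1 := (hasDerivAt_cutIntegral_cauchyKernel
      (hd.continuousOn.mono (Metric.closedBall_subset_ball hρ)) hp).comp w hJ
    have hRw : (R : ℂ) * w ∈ Metric.ball (0 : ℂ) 1 :=
      mul_mem_ball_of_mem_ball hR (Metric.ball_subset_ball hρ.le hwB)
    have h2 : HasDerivAt (fun v => Fdisc φ (R * v)) (deriv (Fdisc φ) (R * w) * R) w := by
      refine (hF.differentiableAt (Metric.isOpen_ball.mem_nhds hRw)).hasDerivAt.comp w ?_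
      simpa using (hasDerivAt_id' w).const_mul (R : ℂ)
    rw [eq_div_iff hJ0]
    refine h1.unique (h2.congr_of_eventuallyEq ?_)
    filter_upwards [isOpen_ne.mem_nhds hw, Metric.isOpen_ball.mem_nhds hwB] with v hv hv1
    exact cutIntegral_cauchy hρ hd (by simp [Fdisc_zero]) hv (mem_ball_zero_iff.1 hv1)
  have hlim : Tendsto (fun R : ℝ => deriv (Fdisc φ) (R * w) * R / J') (𝓝[Ioo 0 1] 1)
      (𝓝 (deriv φ (joukowski w))) := by
    have hc : ContinuousAt (fun R : ℝ => deriv (Fdisc φ) (R * w) * R / J') 1 := by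
      refine ContinuousAt.div_const (ContinuousAt.mul (ContinuousAt.comp
        (g := deriv (Fdisc φ)) ?_ (by fun_prop)) (by fun_prop)) _
      rw [Complex.ofReal_one, one_mul]
      exact (hF.deriv Metric.isOpen_ball).continuousOn.continuousAt
        (Metric.isOpen_ball.mem_nhds hwB)
    have := hc.tendsto.mono_left (nhdsWithin_le_nhds (s := Ioo 0 1))
    rwa [Complex.ofReal_one, one_mul, mul_one, ← hderiv, mul_div_cancel_right₀ _ hJ0] at this
  refine hlim.congr' ?_
  filter_upwards [self_mem_nhdsWithin] with R h using (hR R h).symm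

lemma tendsto_cutIntegral_dilation {φ : ℂ → ℂ} (hφ : φ ∈ O1 0 1) {p : ℂ} (hp : p ∈ cutPlane 0 1) :
    Tendsto (fun R : ℝ => cutIntegral (fun w => Fdisc φ (R * w)) fun y => ((y : ℂ) - p)⁻¹)
      (𝓝[Ioo 0 1] 1) (𝓝 (φ p)) := by
  obtain ⟨w, hw, hw1, rfl⟩ := exists_joukowski_eq hp
  have hc : ContinuousAt (fun R : ℝ => Fdisc φ (R * w)) 1 := by
    refine ContinuousAt.comp (g := Fdisc φ) ?_ (by fun_prop)
    rw [Complex.ofReal_one, one_mul]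
    exact (differentiableOn_Fdisc hφ).continuousOn.continuousAt
      (Metric.isOpen_ball.mem_nhds (mem_ball_zero_iff.2 hw1))
  have := hc.tendsto.mono_left (nhdsWithin_le_nhds (s := Ioo 0 1))
  rw [Complex.ofReal_one, one_mul, Fdisc_of_ne hw] at this
  refine this.congr' ?_
  filter_upwards [self_mem_nhdsWithin] with R hR
  exact (cutIntegral_cauchy ((one_lt_inv₀ hR.1).2 hR.2) (differentiableOn_Fdisc_mul hφ hR)
    (by simp [Fdisc_zero]) hw hw1).symm

namespace MoebiusData

variable {a b c d : ℝ} (hg : MoebiusData a b c d)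
include hg

lemma tendsto_discOp_dilation {φ : ℂ → ℂ} (hφ : φ ∈ O1 0 1) {ω : ℂ} (h0 : ω ≠ 0) (hω : ‖ω‖ < 1) :
    Tendsto (fun R : ℝ => discOp a b c d (fun w => Fdisc φ (R * w)) ω) (𝓝[Ioo 0 1] 1)
      (𝓝 ((a - c * joukowski ω) * (φ ((d * joukowski ω - b) / (a - c * joukowski ω)) -
        φ (-(d : ℂ) / c)) - (a * d - b * c) / c * deriv φ (-(d : ℂ) / c))) := by
  have hz := joukowski_mem_cutPlane h0 hω
  refine ((((tendsto_cutIntegral_dilation hφ (hg.image_mem_cutPlane hz)).sub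
    (tendsto_cutIntegral_dilation hφ hg.pole_mem_cutPlane)).const_mul _).sub
    ((tendsto_cutIntegral_dilation_sq hφ hg.pole_mem_cutPlane).const_mul _)).congr' ?_
  filter_upwards [self_mem_nhdsWithin] with R hR
  exact (hg.discOp_eq ((differentiableOn_Fdisc_mul hφ hR).continuousOn.mono
    (Metric.closedBall_subset_ball ((one_lt_inv₀ hR.1).2 hR.2))) h0 hω).symm

/-- The `H¹` norm estimate for any `ψ` whose transfer to the disc is the limit of
`discOp a b c d` on the dilations of `φ`. -/
lemma Hnorm_le {φ ψ : ℂ → ℂ} (hφ : φ ∈ O1 0 1)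
    (hψ : ∀ z, ψ z = (a - c * z) * (φ ((d * z - b) / (a - c * z)) - φ (-(d : ℂ) / c)) -
      (a * d - b * c) / c * deriv φ (-(d : ℂ) / c)) :
    Hnorm ψ ≤ ENNReal.ofReal ((16 * Real.log (1 + d) + 3 / 2) / (d ^ 2 * √(b * (d - b)))) *
      Hnorm φ := by
  set K := (16 * Real.log (1 + d) + 3 / 2) / (d ^ 2 * √(b * (d - b))) with hK
  have hK0 : 0 ≤ K := by
    have := Real.log_nonneg (show 1 ≤ 1 + d by linarith [hg.d_pos])
    positivity
  have hpi := Real.pi_pos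
  refine iSup_le fun ⟨r, hr⟩ => ?_
  obtain ⟨R, -, hR, hRlim⟩ := exists_seq_strictMono_tendsto' (zero_lt_one' ℝ)
  have hRlim' : Tendsto R atTop (𝓝[Ioo 0 1] 1) :=
    tendsto_nhdsWithin_iff.2 ⟨hRlim, Eventually.of_forall hR⟩
  set G : ℕ → ℝ → ℂ := fun n θ =>
    discOp a b c d (fun w => Fdisc φ (R n * w)) (r * Complex.exp (θ * I))
  have hρ : ∀ n, 1 < (R n)⁻¹ := fun n => (one_lt_inv₀ (hR n).1).2 (hR n).2
  have hpt : ∀ θ : ℝ, Tendsto (fun n => G n θ) atTop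
      (𝓝 (Fdisc ψ (r * Complex.exp (θ * I)))) := by
    intro θ
    have h0 : (r : ℂ) * Complex.exp (θ * I) ≠ 0 :=
      mul_ne_zero (by exact_mod_cast hr.1.ne') (Complex.exp_ne_zero _)
    rw [Fdisc_of_ne h0, hψ]
    exact (hg.tendsto_discOp_dilation hφ h0
      ((norm_ofReal_mul_exp hr.1.le θ).trans_lt hr.2)).comp hRlim'
  have hbound : ∀ n, ∫⁻ θ in Ioc (0 : ℝ) (2 * Real.pi), ‖G n θ‖ₑ ≤
      ENNReal.ofReal (2 * Real.pi * K) * Hnorm φ := fun n => by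
    refine (hg.lintegral_discOp_le (hρ n) (differentiableOn_Fdisc_mul hφ (hR n))
      (by simp [Fdisc_zero]) hr.1 hr.2).trans ?_
    rw [ENNReal.ofReal_mul (by positivity)]
    gcongr
    exact ofReal_circleMean_le_Hnorm φ (hR n)
  have hcont : ∀ n, Continuous (G n) := fun n =>
    continuous_comp_circle (hg.differentiableOn_discOp
      ((differentiableOn_Fdisc_mul hφ (hR n)).continuousOn.mono
        (Metric.closedBall_subset_ball (hρ n)))).continuousOn hr.1.le hr.2
  have hfatou : ∫⁻ θ in Ioc (0 : ℝ) (2 * Real.pi), ‖Fdisc ψ (r * Complex.exp (θ * I))‖ₑ ≤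
      ENNReal.ofReal (2 * Real.pi * K) * Hnorm φ := by
    calc _ = ∫⁻ θ in Ioc (0 : ℝ) (2 * Real.pi), liminf (fun n => ‖G n θ‖ₑ) atTop := by
          congr 1; funext θ; exact (hpt θ).enorm.liminf_eq.symm
      _ ≤ liminf (fun n => ∫⁻ θ in Ioc (0 : ℝ) (2 * Real.pi), ‖G n θ‖ₑ) atTop :=
          MeasureTheory.lintegral_liminf_le fun n => (hcont n).enorm.measurable
      _ ≤ _ := (liminf_le_liminf (Eventually.of_forall hbound)).trans_eq (liminf_const _)
  have hmean_le : ENNReal.ofReal (∫ θ in (0 : ℝ)..(2 * Real.pi),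
      ‖Fdisc ψ (r * Complex.exp (θ * I))‖) ≤
      ∫⁻ θ in Ioc (0 : ℝ) (2 * Real.pi), ‖Fdisc ψ (r * Complex.exp (θ * I))‖ₑ := by
    rw [intervalIntegral.integral_of_le (by positivity)]
    have hm : MeasureTheory.StronglyMeasurable fun θ : ℝ => Fdisc ψ (r * Complex.exp (θ * I)) :=
      stronglyMeasurable_of_tendsto atTop (fun n => (hcont n).stronglyMeasurable)
        (tendsto_pi_nhds.2 hpt)
    rw [MeasureTheory.integral_norm_eq_lintegral_enorm hm.aestronglyMeasurable]
    exact ENNReal.ofReal_toReal_le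
  rw [ENNReal.ofReal_mul (by positivity)]
  calc _ ≤ ENNReal.ofReal (2 * Real.pi)⁻¹ * (ENNReal.ofReal (2 * Real.pi * K) * Hnorm φ) := by
        gcongr; exact hmean_le.trans hfatou
    _ = _ := by
        rw [← mul_assoc, ← ENNReal.ofReal_mul (by positivity), inv_mul_cancel_left₀ (by positivity)]

end MoebiusData

/-- Matrices of `ℳ` other than the identity and `(0 1; 1 1)` have `d > b > 0` and `c > 0`. -/
lemma moebiusData_of_mem_Mmon {g : Matrix (Fin 2) (Fin 2) ℤ} (hg : g ∈ Mmon) (h1 : g ≠ 1)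
    (h2 : g ≠ gmat 1) : MoebiusData (g 0 0) (g 0 1) (g 1 0) (g 1 1) := by
  obtain rfl | ⟨hdet, hbd, hab, ha, hcd, hac⟩ := hg
  · exact absurd rfl h1
  have hgm : g = !![g 0 0, g 0 1; g 1 0, g 1 1] := Matrix.eta_fin_two g
  generalize g 0 0 = a at *
  generalize g 0 1 = b at *
  generalize g 1 0 = c at *
  generalize g 1 1 = d at *
  have hb : 0 < b := by
    by_contra h
    obtain rfl : b = 0 := by omega
    obtain rfl : a = 0 := by omega
    simp at hdet
  have hc : 0 < c := by
    by_contra h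
    obtain rfl : c = 0 := by omega
    obtain rfl : a = 0 := by omega
    simp at hdet
  have hlt : b < d := by
    refine lt_of_le_of_ne hbd fun h => h2 ?_
    subst h
    have hu : IsUnit b := by
      rw [Int.isUnit_iff]
      have : b ∣ 1 := by
        rcases hdet with h | h
        · exact ⟨a - c, by linear_combination -h⟩
        · exact ⟨c - a, by linear_combination h⟩
      exact Int.isUnit_iff.1 (isUnit_of_dvd_one this)
    obtain rfl : b = 1 := by rcases Int.isUnit_iff.1 hu with h | h <;> omega
    obtain rfl : c = 1 := by omega
    obtain rfl : a = 0 := by omega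
    exact hgm
  refine ⟨by exact_mod_cast ha, by exact_mod_cast hac, by exact_mod_cast hb,
    by exact_mod_cast hlt, by exact_mod_cast hc, by exact_mod_cast hcd, ?_⟩
  have : (a * d - b * c) ^ 2 = 1 := by rcases hdet with h | h <;> rw [h] <;> norm_num
  exact_mod_cast this

lemma operator_bound_le {b d : ℝ} (hb : 0 < b) (hbd : b < d) (hd : 2 ≤ d) :
    (16 * Real.log (1 + d) + 3 / 2) / (d ^ 2 * √(b * (d - b))) ≤
      25 * d ^ (-(5 : ℝ) / 2) * min b (d - b) ^ (-(1 : ℝ) / 2) * Real.log (1 + d) := by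
  have hd0 : 0 < d := by linarith
  set m := min b (d - b) with hm
  have hm0 : 0 < m := lt_min hb (by linarith)
  have hL : 1 ≤ Real.log (1 + d) := by
    rw [Real.le_log_iff_exp_le (by linarith)]
    linarith [Real.exp_one_lt_d9]
  have hmd : m * d / 2 ≤ b * (d - b) := by
    rcases le_total b (d - b) with h | h
    · rw [hm, min_eq_left h]; nlinarith
    · rw [hm, min_eq_right h]; nlinarith
  have h5 : d ^ (-(5 : ℝ) / 2) = (d ^ 2 * √d)⁻¹ := by
    rw [Real.sqrt_eq_rpow, ← Real.rpow_natCast, ← Real.rpow_add hd0, ← Real.rpow_neg hd0.le]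
    norm_num
  have h1 : m ^ (-(1 : ℝ) / 2) = (√m)⁻¹ := by
    rw [Real.sqrt_eq_rpow, ← Real.rpow_neg hm0.le]; norm_num
  have hs : √m * √d ≤ 10 / 7 * √(b * (d - b)) := by
    rw [← Real.sqrt_mul hm0.le]
    refine (Real.sqrt_le_sqrt (show m * d ≤ (10 / 7) ^ 2 * (b * (d - b)) by
      nlinarith [mul_pos hb (sub_pos.2 hbd)])).trans_eq ?_
    rw [Real.sqrt_mul (by norm_num), Real.sqrt_sq (by norm_num)]
  have hsb : 0 < √(b * (d - b)) := Real.sqrt_pos.2 (mul_pos hb (sub_pos.2 hbd))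
  have hsm := Real.sqrt_pos.2 hm0
  have hsd := Real.sqrt_pos.2 hd0
  rw [h5, h1]
  calc _ ≤ 25 * Real.log (1 + d) / (d ^ 2 * (10 / 7 * √(b * (d - b)))) := by
        rw [div_le_div_iff₀ (by positivity) (by positivity)]
        have : 0 < d ^ 2 * √(b * (d - b)) := by positivity
        nlinarith
    _ ≤ 25 * Real.log (1 + d) / (d ^ 2 * (√m * √d)) := by gcongr
    _ = _ := by field_simp

/-- the `H¹` operator-norm estimate for `L_g`, `g ∈ ℳ`,
`g ∉ {id, (0 1; 1 1)}` (Proposition 4.9). -/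
theorem Lg_H1_norm_estimate :
    ∃ K > 0, ∀ g ∈ Mmon, g ≠ 1 → g ≠ gmat 1 →
      ∀ φ ∈ O1 0 1, Hnorm φ < ⊤ →
        Hnorm (Lop g φ) ≤
          ENNReal.ofReal
              (K * (g 1 1 : ℝ) ^ (-(5 : ℝ) / 2) *
                ((min (g 0 1) (g 1 1 - g 0 1) : ℤ) : ℝ) ^ (-(1 : ℝ) / 2) *
                Real.log (1 + (g 1 1 : ℝ))) *
            Hnorm φ := by
  refine ⟨25, by norm_num, fun g hg h1 h2 φ hφ _ => ?_⟩
  have hM := moebiusData_of_mem_Mmon hg h1 h2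
  have hd : (2 : ℝ) ≤ g 1 1 := by
    have hb : (0 : ℤ) < g 0 1 := by exact_mod_cast hM.b_pos
    have hbd : g 0 1 < g 1 1 := by exact_mod_cast hM.b_lt_d
    exact_mod_cast (show (2 : ℤ) ≤ g 1 1 by omega)
  refine (hM.Hnorm_le hφ fun z => ?_).trans ?_
  · simp only [Lop, if_neg h1]
    push_cast
    ring
  · gcongr
    push_cast
    exact operator_bound_le hM.b_pos hM.b_lt_d hd

end
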